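/- arXiv:2108.06263 — 3 statements merged into one kernel-verified Lean document; each statement's English description precedes it below -/
import Mathlib

section
/- The exponent of matrix multiplication may be computed with border rank in place of rank: inf{τ ∈ ℝ : ∃ C > 0 such that R(M⟨n⟩) ≤ C·n^τ for all n ≥ 1} = inf{τ ∈ ℝ : ∃ C > 0 such that BR(M⟨n⟩) ≤ C·n^τ for all n ≥ 1}. -/
open scoped BigOperators

noncomputable section

/-- A tensor `T ∈ ℂ^{ι₁} ⊗ ℂ^{ι₂} ⊗ ℂ^{ι₃}`, written in coordinates, has rank at most `r`
if it is a sum of `r` simple tensors. -/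
def rankLE {ι₁ ι₂ ι₃ : Type*} (T : ι₁ → ι₂ → ι₃ → ℂ) (r : ℕ) : Prop :=
  ∃ u : Fin r → ι₁ → ℂ, ∃ v : Fin r → ι₂ → ℂ, ∃ w : Fin r → ι₃ → ℂ,
    T = fun i j k => ∑ l, u l i * v l j * w l k

/-- The rank of a tensor. -/
def trank {ι₁ ι₂ ι₃ : Type*} (T : ι₁ → ι₂ → ι₃ → ℂ) : ℕ :=
  sInf {r | rankLE T r}

/-- The border rank of a tensor: the least `r` such that `T` is a limit of tensors of rank
at most `r` (closure in the Euclidean = product topology). -/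
def brank {ι₁ ι₂ ι₃ : Type*} [Fintype ι₁] [Fintype ι₂] [Fintype ι₃]
    (T : ι₁ → ι₂ → ι₃ → ℂ) : ℕ :=
  sInf {r | T ∈ closure {S : ι₁ → ι₂ → ι₃ → ℂ | rankLE S r}}

/-- The matrix multiplication tensor `M⟨a,b,c⟩ = Σ e_{ij} ⊗ e_{jk} ⊗ e_{ki}`. -/
def matMulTensor (a b c : ℕ) :
    (Fin a × Fin b) → (Fin b × Fin c) → (Fin c × Fin a) → ℂ :=
  fun x y z => if x.2 = y.1 ∧ y.2 = z.1 ∧ z.2 = x.1 then 1 else 0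

/-- Kronecker product of tensors. -/
def kron {ι₁ ι₂ ι₃ κ₁ κ₂ κ₃ : Type*} (T : ι₁ → ι₂ → ι₃ → ℂ) (T' : κ₁ → κ₂ → κ₃ → ℂ) :
    (ι₁ × κ₁) → (ι₂ × κ₂) → (ι₃ × κ₃) → ℂ :=
  fun i j k => T i.1 j.1 k.1 * T' i.2 j.2 k.2

/-- The little Coppersmith–Winograd tensor
`cw_q = Σ_{i=1}^q (e₀⊗eᵢ⊗eᵢ + eᵢ⊗e₀⊗eᵢ + eᵢ⊗eᵢ⊗e₀)`. -/
def cw (q : ℕ) : Fin (q + 1) → Fin (q + 1) → Fin (q + 1) → ℂ :=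
  fun i j k =>
    if (i.val = 0 ∧ j = k ∧ j.val ≠ 0) ∨ (j.val = 0 ∧ i = k ∧ i.val ≠ 0) ∨
       (k.val = 0 ∧ i = j ∧ i.val ≠ 0)
    then 1 else 0

/-- The big Coppersmith–Winograd tensor `CW_{m-2} ∈ ℂ^m ⊗ ℂ^m ⊗ ℂ^m` (for `m ≥ 3`). -/
def bigCW (m : ℕ) : Fin m → Fin m → Fin m → ℂ :=
  fun i j k =>
    if (i.val = 0 ∧ j.val = 0 ∧ k.val = m - 1) ∨
       (i.val = 0 ∧ j.val = m - 1 ∧ k.val = 0) ∨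
       (i.val = m - 1 ∧ j.val = 0 ∧ k.val = 0) ∨
       (i.val = 0 ∧ j = k ∧ 1 ≤ j.val ∧ j.val ≤ m - 2) ∨
       (j.val = 0 ∧ i = k ∧ 1 ≤ i.val ∧ i.val ≤ m - 2) ∨
       (k.val = 0 ∧ i = j ∧ 1 ≤ i.val ∧ i.val ≤ m - 2)
    then 1 else 0

/-- The skew Coppersmith–Winograd tensor `T_{skewcw,2} ∈ ℂ³⊗ℂ³⊗ℂ³`. -/
def skewCW2 : Fin 3 → Fin 3 → Fin 3 → ℂ :=
  fun i j k =>
    if (i = 0 ∧ j = 1 ∧ k = 1) ∨ (i = 0 ∧ j = 2 ∧ k = 2) ∨ (i = 1 ∧ j = 0 ∧ k = 1) ∨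
       (i = 2 ∧ j = 0 ∧ k = 2) ∨ (i = 1 ∧ j = 2 ∧ k = 0)
    then 1
    else if i = 2 ∧ j = 1 ∧ k = 0 then -1 else 0

/-- Action of a triple of linear maps (matrices) on a tensor. -/
def triApply {a b c a' b' c' : ℕ}
    (g₁ : Matrix (Fin a') (Fin a) ℂ) (g₂ : Matrix (Fin b') (Fin b) ℂ)
    (g₃ : Matrix (Fin c') (Fin c) ℂ) (T : Fin a → Fin b → Fin c → ℂ) :
    Fin a' → Fin b' → Fin c' → ℂ :=
  fun i j k => ∑ i', ∑ j', ∑ k', g₁ i i' * g₂ j j' * g₃ k k' * T i' j' k'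

/-- The unit (diagonal) tensor `I_r ∈ ℂ^r ⊗ ℂ^r ⊗ ℂ^r`. -/
def unitTensor (r : ℕ) : Fin r → Fin r → Fin r → ℂ :=
  fun i j k => if i = j ∧ j = k then 1 else 0

/-- The unit tensor `I_r = Σ_{ℓ=1}^r a_ℓ⊗b_ℓ⊗c_ℓ` embedded in `ℂ^a ⊗ ℂ^b ⊗ ℂ^c`
(for `r ≤ min{a,b,c}`). -/
def unitIn (a b c r : ℕ) : Fin a → Fin b → Fin c → ℂ :=
  fun i j k => if i.val = j.val ∧ j.val = k.val ∧ i.val < r then 1 else 0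

/-- The subrank `Q(T)`: largest `r` so that linear maps take `T` to the unit tensor `I_r`. -/
def subrank {a b c : ℕ} (T : Fin a → Fin b → Fin c → ℂ) : ℕ :=
  sSup {r | ∃ f : Matrix (Fin r) (Fin a) ℂ, ∃ g : Matrix (Fin r) (Fin b) ℂ,
    ∃ h : Matrix (Fin r) (Fin c) ℂ, triApply f g h T = unitTensor r}

/-- The `GL(A) × GL(B) × GL(C)`-orbit of a tensor. -/
def glOrbit {a b c : ℕ} (T : Fin a → Fin b → Fin c → ℂ) :
    Set (Fin a → Fin b → Fin c → ℂ) :=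
  {S | ∃ g₁ : Matrix (Fin a) (Fin a) ℂ, ∃ g₂ : Matrix (Fin b) (Fin b) ℂ,
    ∃ g₃ : Matrix (Fin c) (Fin c) ℂ, IsUnit g₁ ∧ IsUnit g₂ ∧ IsUnit g₃ ∧
      S = triApply g₁ g₂ g₃ T}

/-- The border subrank `Q̲(T)`: largest `r` (with `r ≤ min{a,b,c}`) such that `I_r` lies in
the closure of the `GL×GL×GL`-orbit of `T`. -/
def bsubrank {a b c : ℕ} (T : Fin a → Fin b → Fin c → ℂ) : ℕ :=
  sSup {r | r ≤ min a (min b c) ∧ unitIn a b c r ∈ closure (glOrbit T)}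

/-- Multilinear rank in the `A`-factor: rank of the contraction `T_A : A* → B⊗C`. -/
def mlA {a b c : ℕ} (T : Fin a → Fin b → Fin c → ℂ) : ℕ :=
  (Matrix.of fun (i : Fin a) (p : Fin b × Fin c) => T i p.1 p.2).rank

/-- Multilinear rank in the `B`-factor. -/
def mlB {a b c : ℕ} (T : Fin a → Fin b → Fin c → ℂ) : ℕ :=
  (Matrix.of fun (j : Fin b) (p : Fin a × Fin c) => T p.1 j p.2).rank

/-- Multilinear rank in the `C`-factor. -/
def mlC {a b c : ℕ} (T : Fin a → Fin b → Fin c → ℂ) : ℕ :=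
  (Matrix.of fun (k : Fin c) (p : Fin a × Fin b) => T p.1 p.2 k).rank

/-- `T` is `1_A`-generic: some contraction `T(α) : B* → C` has full rank `m`. -/
def oneAGeneric {m : ℕ} (T : Fin m → Fin m → Fin m → ℂ) : Prop :=
  ∃ α : Fin m → ℂ, (Matrix.of fun j k => ∑ i, α i * T i j k).rank = m

def oneBGeneric {m : ℕ} (T : Fin m → Fin m → Fin m → ℂ) : Prop :=
  ∃ β : Fin m → ℂ, (Matrix.of fun i k => ∑ j, β j * T i j k).rank = m

def oneCGeneric {m : ℕ} (T : Fin m → Fin m → Fin m → ℂ) : Prop :=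
  ∃ γ : Fin m → ℂ, (Matrix.of fun i j => ∑ k, γ k * T i j k).rank = m

/-- `T` is `1`-generic. -/
def oneGeneric {m : ℕ} (T : Fin m → Fin m → Fin m → ℂ) : Prop :=
  oneAGeneric T ∧ oneBGeneric T ∧ oneCGeneric T

/-- The symmetry Lie algebra `g̃_T ⊂ gl(A) ⊕ gl(B) ⊕ gl(C)` of a tensor, as a set. -/
def symLieSet {m : ℕ} (T : Fin m → Fin m → Fin m → ℂ) :
    Set (Matrix (Fin m) (Fin m) ℂ × Matrix (Fin m) (Fin m) ℂ × Matrix (Fin m) (Fin m) ℂ) :=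
  {XYZ | ∀ i j k, (∑ i', XYZ.1 i i' * T i' j k) + (∑ j', XYZ.2.1 j j' * T i j' k) +
    (∑ k', XYZ.2.2 k k' * T i j k') = 0}


theorem rankLE_of_fintype {ι₁ ι₂ ι₃ L : Type*} [Fintype L] (T : ι₁ → ι₂ → ι₃ → ℂ)
    (u : L → ι₁ → ℂ) (v : L → ι₂ → ℂ) (w : L → ι₃ → ℂ)
    (h : ∀ i j k, T i j k = ∑ l, u l i * v l j * w l k) : rankLE T (Fintype.card L) := by
  let e := Fintype.equivFin L
  refine ⟨fun l => u (e.symm l), fun l => v (e.symm l), fun l => w (e.symm l), ?_⟩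
  funext i j k
  rw [h]
  exact (Equiv.sum_comp e.symm (fun l => u l i * v l j * w l k)).symm

theorem rankLE_card {ι₁ ι₂ ι₃ : Type*} [Fintype ι₁] [Fintype ι₂] (T : ι₁ → ι₂ → ι₃ → ℂ) :
    rankLE T (Fintype.card (ι₁ × ι₂)) := by
  classical
  refine rankLE_of_fintype T (fun l i => if i = l.1 then 1 else 0)
    (fun l j => if j = l.2 then 1 else 0) (fun l k => T l.1 l.2 k) ?_
  intro i j k
  rw [Fintype.sum_prod_type]
  simp

theorem trank_spec {ι₁ ι₂ ι₃ : Type*} [Fintype ι₁] [Fintype ι₂] (T : ι₁ → ι₂ → ι₃ → ℂ) :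
    rankLE T (trank T) :=
  Nat.sInf_mem (s := {r | rankLE T r}) ⟨_, rankLE_card T⟩

theorem brank_le_trank {ι₁ ι₂ ι₃ : Type*} [Fintype ι₁] [Fintype ι₂] [Fintype ι₃]
    (T : ι₁ → ι₂ → ι₃ → ℂ) : brank T ≤ trank T :=
  Nat.sInf_le (subset_closure (trank_spec T))

theorem brank_spec {ι₁ ι₂ ι₃ : Type*} [Fintype ι₁] [Fintype ι₂] [Fintype ι₃]
    (T : ι₁ → ι₂ → ι₃ → ℂ) : T ∈ closure {S : ι₁ → ι₂ → ι₃ → ℂ | rankLE S (brank T)} :=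
  Nat.sInf_mem (s := {r | T ∈ closure {S : ι₁ → ι₂ → ι₃ → ℂ | rankLE S r}})
    ⟨_, subset_closure (trank_spec T)⟩

theorem one_le_brank {ι₁ ι₂ ι₃ : Type*} [Fintype ι₁] [Fintype ι₂] [Fintype ι₃]
    (T : ι₁ → ι₂ → ι₃ → ℂ) (hT : T ≠ 0) : 1 ≤ brank T := by
  by_contra h
  have h0 : brank T = 0 := by omega
  have := brank_spec T
  rw [h0] at this
  have hs : {S : ι₁ → ι₂ → ι₃ → ℂ | rankLE S 0} ⊆ {0} := by
    rintro S ⟨u, v, w, rfl⟩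
    ext i j k
    simp
  have h2 := closure_mono hs this
  rw [closure_singleton] at h2
  exact hT h2

/-- All monomials of degree at most `N` in each of the coordinates of `S`. -/
def monoms {ι₁ ι₂ ι₃ : Type*} [Fintype ι₁] [Fintype ι₂] [Fintype ι₃] (N : ℕ)
    (S : ι₁ → ι₂ → ι₃ → ℂ) : ((ι₁ × ι₂ × ι₃) → Fin (N + 1)) → ℂ :=
  fun α => ∏ x, S x.1 x.2.1 x.2.2 ^ (α x).val

theorem prod_eq_monoms {ι₁ ι₂ ι₃ : Type*} [Fintype ι₁] [Fintype ι₂] [Fintype ι₃]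
    (N : ℕ) (i : Fin N → ι₁) (j : Fin N → ι₂) (k : Fin N → ι₃) :
    ∃ α : (ι₁ × ι₂ × ι₃) → Fin (N + 1), ∀ S : ι₁ → ι₂ → ι₃ → ℂ,
      ∏ t, S (i t) (j t) (k t) = monoms N S α := by
  classical
  refine ⟨fun x => ⟨(Finset.univ.filter fun t => (i t, j t, k t) = x).card, ?_⟩, ?_⟩
  · have := Finset.card_filter_le (Finset.univ : Finset (Fin N)) fun t => (i t, j t, k t) = x
    simp only [Finset.card_univ, Fintype.card_fin] at this
    omega
  · intro S
    simp only [monoms]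
    rw [← Finset.prod_fiberwise Finset.univ (fun t => (i t, j t, k t))]
    refine Finset.prod_congr rfl fun x _ => ?_
    rw [← Finset.prod_const]
    refine Finset.prod_congr rfl fun t ht => ?_
    rw [← (Finset.mem_filter.1 ht).2]

/-- A tensor power of a tensor of border rank `r` is a combination of few powers of tensors
of rank at most `r`. -/
theorem monoms_combination {ι₁ ι₂ ι₃ : Type*} [Fintype ι₁] [Fintype ι₂] [Fintype ι₃]
    (N : ℕ) (T : ι₁ → ι₂ → ι₃ → ℂ) :
    ∃ D : ℕ, D ≤ (N + 1) ^ Fintype.card (ι₁ × ι₂ × ι₃) ∧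
      ∃ S : Fin D → ι₁ → ι₂ → ι₃ → ℂ, (∀ a, rankLE (S a) (brank T)) ∧
      ∃ c : Fin D → ℂ, monoms N T = ∑ a, c a • monoms N (S a) := by
  classical
  set X := {S : ι₁ → ι₂ → ι₃ → ℂ | rankLE S (brank T)} with hX
  set P := Submodule.span ℂ (Set.image (monoms N) X) with hP
  have hcont : Continuous (monoms (ι₁ := ι₁) (ι₂ := ι₂) (ι₃ := ι₃) N) := by
    unfold monoms
    fun_prop
  have hmem : monoms N T ∈ P := by
    have h1 : monoms N T ∈ closure (P : Set _) :=
      map_mem_closure hcont (brank_spec T)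
        (fun S hS => Submodule.subset_span (Set.mem_image_of_mem _ hS))
    rwa [(Submodule.closed_of_finiteDimensional P).closure_eq] at h1
  obtain ⟨f, hf, hspan, -⟩ := Submodule.exists_fun_fin_finrank_span_eq ℂ (Set.image (monoms N) X)
  refine ⟨Module.finrank ℂ (Submodule.span ℂ (Set.image (monoms N) X)), ?_, ?_⟩
  rotate_left
  · choose S hS hSf using hf
    refine ⟨S, hS, ?_⟩
    rw [hP, ← hspan, Submodule.mem_span_range_iff_exists_fun] at hmem
    obtain ⟨c, hc⟩ := hmem
    refine ⟨c, ?_⟩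
    rw [← hc]
    simp only [hSf]
  · refine (Submodule.finrank_le _).trans ?_
    simp

theorem trank_matMul_le (n N m : ℕ) (hm : m ≤ n ^ N) :
    trank (matMulTensor m m m) ≤
      (N + 1) ^ Fintype.card ((Fin n × Fin n) × (Fin n × Fin n) × (Fin n × Fin n)) *
        brank (matMulTensor n n n) ^ N := by
  classical
  obtain ⟨D, hD, S, hS, c, hc⟩ := monoms_combination N (matMulTensor n n n)
  set r := brank (matMulTensor n n n)
  choose u v w huvw using hS
  obtain ⟨φ, hφ⟩ : ∃ φ : Fin m → (Fin N → Fin n), Function.Injective φ :=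
    ⟨fun x => finFunctionFinEquiv.symm (Fin.castLE hm x),
      finFunctionFinEquiv.symm.injective.comp (Fin.castLE_injective hm)⟩
  have key : rankLE (matMulTensor m m m) (Fintype.card (Fin D × (Fin N → Fin r))) := by
    refine rankLE_of_fintype _
      (fun l x => c l.1 * ∏ t, u l.1 (l.2 t) (φ x.1 t, φ x.2 t))
      (fun l x => ∏ t, v l.1 (l.2 t) (φ x.1 t, φ x.2 t))
      (fun l x => ∏ t, w l.1 (l.2 t) (φ x.1 t, φ x.2 t)) ?_
    intro x y z
    have h1 : matMulTensor m m m x y z =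
        ∏ t, matMulTensor n n n (φ x.1 t, φ x.2 t) (φ y.1 t, φ y.2 t) (φ z.1 t, φ z.2 t) := by
      simp only [matMulTensor, Finset.prod_ite_zero, Finset.prod_const_one]
      refine if_congr ?_ rfl rfl
      simp only [Finset.mem_univ, true_imp_iff, forall_const]
      rw [← hφ.eq_iff, ← hφ.eq_iff (a := y.2), ← hφ.eq_iff (a := z.2)]
      simp only [funext_iff, forall_and]
    obtain ⟨α, hα⟩ := prod_eq_monoms N (fun t => (φ x.1 t, φ x.2 t))
      (fun t => (φ y.1 t, φ y.2 t)) (fun t => (φ z.1 t, φ z.2 t))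
    rw [h1, hα, hc, Fintype.sum_prod_type, Finset.sum_apply]
    refine Finset.sum_congr rfl fun a _ => ?_
    rw [Pi.smul_apply, smul_eq_mul, ← hα, huvw a]
    simp only []
    rw [Finset.prod_univ_sum, Finset.mul_sum, Fintype.piFinset_univ]
    refine Finset.sum_congr rfl fun f _ => ?_
    rw [Finset.prod_mul_distrib, Finset.prod_mul_distrib]
    ring
  refine (Nat.sInf_le key).trans ?_
  simp only [Fintype.card_prod, Fintype.card_pi, Fintype.card_fin, Finset.prod_const,
    Finset.card_univ] at hD ⊢
  exact Nat.mul_le_mul_right _ hD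

theorem matMul_ne_zero (n : ℕ) (hn : 1 ≤ n) : matMulTensor n n n ≠ 0 := by
  intro h
  have := congrFun (congrFun (congrFun h (⟨0, hn⟩, ⟨0, hn⟩)) (⟨0, hn⟩, ⟨0, hn⟩))
    (⟨0, hn⟩, ⟨0, hn⟩)
  simp [matMulTensor] at this

theorem nonneg_of_bound (τ C : ℝ)
    (h : ∀ n : ℕ, 1 ≤ n → (brank (matMulTensor n n n) : ℝ) ≤ C * (n : ℝ) ^ τ) : 0 ≤ τ := by
  by_contra hτ
  push Not at hτ
  have ht : Filter.Tendsto (fun n : ℕ => C * (n : ℝ) ^ τ) Filter.atTop (nhds (C * 0)) := by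
    refine Filter.Tendsto.const_mul C ?_
    have := (tendsto_rpow_neg_atTop (y := -τ) (by linarith)).comp
      (tendsto_natCast_atTop_atTop (R := ℝ))
    simpa [Function.comp_def] using this
  rw [mul_zero] at ht
  obtain ⟨n, hn1, hn2⟩ := ((ht.eventually (gt_mem_nhds (zero_lt_one))).and
    (Filter.eventually_ge_atTop 1)).exists
  have h1 : (1 : ℝ) ≤ brank (matMulTensor n n n) := by
    exact_mod_cast one_le_brank _ (matMul_ne_zero n hn2)
  have := h n hn2
  linarith

theorem poly_le_exp (d : ℕ) (q : ℝ) (hq : 1 < q) :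
    ∃ K : ℝ, 0 < K ∧ ∀ N : ℕ, ((N : ℝ) + 1) ^ d ≤ K * q ^ N := by
  have ht := tendsto_pow_const_div_const_pow_of_one_lt d hq
  obtain ⟨B, hB⟩ := ht.bddAbove_range
  have hq0 : (0 : ℝ) < q := by linarith
  refine ⟨(|B| + 1) * q, by positivity, fun N => ?_⟩
  have h1 : ((N + 1 : ℕ) : ℝ) ^ d / q ^ (N + 1) ≤ B := hB ⟨N + 1, rfl⟩
  rw [div_le_iff₀ (by positivity)] at h1
  push_cast at h1
  calc ((N : ℝ) + 1) ^ d ≤ B * q ^ (N + 1) := h1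
    _ ≤ (|B| + 1) * q ^ (N + 1) := by
        gcongr
        linarith [le_abs_self B]
    _ = (|B| + 1) * q * q ^ N := by ring

theorem rank_bound_of_brank_bound (τ ε C : ℝ) (hε : 0 < ε) (hC : 0 < C)
    (h : ∀ n : ℕ, 1 ≤ n → (brank (matMulTensor n n n) : ℝ) ≤ C * (n : ℝ) ^ τ) :
    ∃ C' : ℝ, 0 < C' ∧
      ∀ n : ℕ, 1 ≤ n → (trank (matMulTensor n n n) : ℝ) ≤ C' * (n : ℝ) ^ (τ + 2 * ε) := by
  have hτ := nonneg_of_bound τ C h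
  have ht : Filter.Tendsto (fun n : ℕ => (n : ℝ) ^ ε) Filter.atTop Filter.atTop :=
    (tendsto_rpow_atTop hε).comp (tendsto_natCast_atTop_atTop (R := ℝ))
  obtain ⟨n, hnC, hn2⟩ := ((ht.eventually_ge_atTop C).and
    (Filter.eventually_ge_atTop 2)).exists
  have hn1R : (1 : ℝ) < n := by exact_mod_cast hn2
  have hn0R : (0 : ℝ) < n := by linarith
  have hr : (brank (matMulTensor n n n) : ℝ) ≤ (n : ℝ) ^ (τ + ε) := by
    refine (h n (by omega)).trans ?_
    rw [add_comm, Real.rpow_add hn0R]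
    gcongr
  obtain ⟨K, hK, hKN⟩ := poly_le_exp
    (Fintype.card ((Fin n × Fin n) × (Fin n × Fin n) × (Fin n × Fin n)))
    ((n : ℝ) ^ ε) (Real.one_lt_rpow hn1R hε)
  refine ⟨K * (n : ℝ) ^ (τ + 2 * ε), by positivity, fun m hm => ?_⟩
  set N := Nat.log n m with hN
  have hmN : m ≤ n ^ (N + 1) := (Nat.lt_pow_succ_log_self (by omega) m).le
  have hNm : n ^ N ≤ m := Nat.pow_log_le_self n (by omega)
  have h1 := trank_matMul_le n (N + 1) m hmN
  have h1R : (trank (matMulTensor m m m) : ℝ) ≤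
      (((N + 1 : ℕ) : ℝ) + 1) ^
        Fintype.card ((Fin n × Fin n) × (Fin n × Fin n) × (Fin n × Fin n)) *
        (brank (matMulTensor n n n) : ℝ) ^ (N + 1) := by exact_mod_cast h1
  have hNmR : (n : ℝ) ^ N ≤ m := by exact_mod_cast hNm
  calc (trank (matMulTensor m m m) : ℝ) ≤ _ := h1R
    _ ≤ (K * ((n : ℝ) ^ ε) ^ (N + 1)) * ((n : ℝ) ^ (τ + ε)) ^ (N + 1) := by
        gcongr
        exact hKN (N + 1)
    _ = K * ((n : ℝ) ^ (τ + 2 * ε)) ^ (N + 1) := by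
        rw [mul_assoc, ← mul_pow, ← Real.rpow_add hn0R]
        ring_nf
    _ = K * (n : ℝ) ^ (τ + 2 * ε) * ((n : ℝ) ^ N) ^ (τ + 2 * ε) := by
        rw [pow_succ, ← Real.rpow_pow_comm hn0R.le]
        ring
    _ ≤ K * (n : ℝ) ^ (τ + 2 * ε) * (m : ℝ) ^ (τ + 2 * ε) := by
        gcongr

theorem trank_bound_four (n : ℕ) :
    (trank (matMulTensor n n n) : ℝ) ≤ 1 * (n : ℝ) ^ (4 : ℝ) := by
  have h : trank (matMulTensor n n n) ≤ _ := Nat.sInf_le (rankLE_card (matMulTensor n n n))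
  simp only [Fintype.card_prod, Fintype.card_fin] at h
  have h' : (trank (matMulTensor n n n) : ℝ) ≤ (n : ℝ) * n * (n * n) := by exact_mod_cast h
  rw [one_mul, show (4 : ℝ) = ((4 : ℕ) : ℝ) by norm_num, Real.rpow_natCast]
  linarith [show (n : ℝ) * n * (n * n) = (n : ℝ) ^ 4 by ring]

/-- the exponent of matrix multiplication may be computed using border rank
in place of rank. -/
theorem exponent_rank_eq_exponent_borderRank :
    sInf {τ : ℝ | ∃ C : ℝ, 0 < C ∧
        ∀ n : ℕ, 1 ≤ n → (trank (matMulTensor n n n) : ℝ) ≤ C * (n : ℝ) ^ τ} =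
    sInf {τ : ℝ | ∃ C : ℝ, 0 < C ∧
        ∀ n : ℕ, 1 ≤ n → (brank (matMulTensor n n n) : ℝ) ≤ C * (n : ℝ) ^ τ} := by
  have hsub : {τ : ℝ | ∃ C : ℝ, 0 < C ∧
        ∀ n : ℕ, 1 ≤ n → (trank (matMulTensor n n n) : ℝ) ≤ C * (n : ℝ) ^ τ} ⊆
      {τ : ℝ | ∃ C : ℝ, 0 < C ∧
        ∀ n : ℕ, 1 ≤ n → (brank (matMulTensor n n n) : ℝ) ≤ C * (n : ℝ) ^ τ} := by
    rintro τ ⟨C, hC, h⟩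
    refine ⟨C, hC, fun n hn => le_trans ?_ (h n hn)⟩
    exact_mod_cast brank_le_trank _
  have hbdd : BddBelow {τ : ℝ | ∃ C : ℝ, 0 < C ∧
        ∀ n : ℕ, 1 ≤ n → (brank (matMulTensor n n n) : ℝ) ≤ C * (n : ℝ) ^ τ} :=
    ⟨0, by rintro τ ⟨C, -, h⟩; exact nonneg_of_bound τ C h⟩
  have hne : {τ : ℝ | ∃ C : ℝ, 0 < C ∧
        ∀ n : ℕ, 1 ≤ n → (trank (matMulTensor n n n) : ℝ) ≤ C * (n : ℝ) ^ τ}.Nonempty :=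
    ⟨4, 1, one_pos, fun n _ => trank_bound_four n⟩
  apply le_antisymm
  · refine le_csInf (hne.mono hsub) ?_
    rintro τ ⟨C, hC, h⟩
    refine le_of_forall_pos_le_add fun ε hε => ?_
    refine csInf_le (hbdd.mono hsub) ?_
    have := rank_bound_of_brank_bound τ (ε / 2) C (by positivity) hC h
    rwa [mul_div_cancel₀ ε two_ne_zero] at this
  · exact csInf_le_csInf hbdd hne hsub

end
end

section
/- The border rank of the 2×2 matrix multiplication tensor equals 7: BR(M⟨2⟩) = 7. -/
open scoped BigOperators

noncomputable section

open Polynomial in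
theorem aux_span_one (N : Submodule ℂ (Fin 2 → ℂ[X])) [FiniteDimensional ℂ N]
    (hN : Module.finrank ℂ N ≤ 2)
    (S : Set (Fin 2 → ℂ[X])) (h1 : ∀ p ∈ S, p ∈ N) (h2 : ∀ p ∈ S, (X : ℂ[X]) • p ∈ N) :
    ∃ p₀ : Fin 2 → ℂ[X], ∀ p ∈ S, ∃ c : ℂ, p = c • p₀ := by
  by_cases hS : ∀ p ∈ S, p = 0
  · exact ⟨0, fun p hp => ⟨0, by simp [hS p hp]⟩⟩
  push Not at hS
  obtain ⟨p₀, hp₀, hne⟩ := hS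
  refine ⟨p₀, ?_⟩
  obtain ⟨j, hj⟩ : ∃ j, p₀ j ≠ 0 := by
    by_contra! h
    exact hne (funext h)
  have hli : LinearIndependent ℂ ![p₀, (X : ℂ[X]) • p₀] := by
    rw [LinearIndependent.pair_iff]
    intro s t hst
    have e := congrFun hst j
    simp only [Pi.add_apply, Pi.smul_apply, smul_eq_mul, Pi.zero_apply] at e
    have e2 : (C s + C t * X) * p₀ j = 0 := by
      rw [← e, smul_eq_C_mul, smul_eq_C_mul]; ring
    have e3 := (mul_eq_zero.mp e2).resolve_right hj
    have c0 := congrArg (fun q => coeff q 0) e3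
    have c1 := congrArg (fun q => coeff q 1) e3
    simp at c0 c1
    exact ⟨c0, c1⟩
  have hspan : Submodule.span ℂ (Set.range ![p₀, (X : ℂ[X]) • p₀]) = N := by
    apply Submodule.eq_of_le_of_finrank_le
    · rw [Submodule.span_le]
      rintro _ ⟨i, rfl⟩
      fin_cases i
      · exact h1 _ hp₀
      · exact h2 _ hp₀
    · rw [finrank_span_eq_card hli]
      simpa using hN
  intro p hp
  have m1 := h1 p hp
  have m2 := h2 p hp
  rw [← hspan] at m1 m2
  rw [Matrix.range_cons, Matrix.range_cons, Matrix.range_empty, Set.union_empty,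
    Set.singleton_union, Submodule.mem_span_pair] at m1 m2
  obtain ⟨a, b, hab⟩ := m1
  obtain ⟨c, d, hcd⟩ := m2
  have e1 := congrFun hab j
  have e2 := congrFun hcd j
  simp only [Pi.add_apply, Pi.smul_apply, smul_eq_mul, smul_eq_C_mul] at e1 e2
  have e3 : (C a * X + C b * X ^ 2 - C c - C d * X) * p₀ j = 0 := by
    linear_combination X * e1 - e2
  have e4 := (mul_eq_zero.mp e3).resolve_right hj
  have c2 := congrArg (fun q => coeff q 2) e4
  simp [coeff_X, coeff_C] at c2
  refine ⟨a, ?_⟩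
  rw [← hab, c2]
  simp

/-- `f` is an orthonormal family for the standard Hermitian form. -/
def ONF {ι : Type*} [Fintype ι] {k : ℕ} (f : Fin k → ι → ℂ) : Prop :=
  ∀ i j, ∑ x, star (f i x) * f j x = if i = j then 1 else 0

/-- `x` is its own orthogonal projection to the span of the `f i`. -/
def SpanMem {ι : Type*} [Fintype ι] {k : ℕ} (f : Fin k → ι → ℂ) (x : ι → ℂ) : Prop :=
  x = ∑ i, (∑ z, star (f i z) * x z) • f i

theorem SpanMem.mem {ι : Type*} [Fintype ι] {k : ℕ} {f : Fin k → ι → ℂ} {x : ι → ℂ}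
    (h : SpanMem f x) : x ∈ Submodule.span ℂ (Set.range f) := by
  rw [h]
  exact Submodule.sum_mem _ fun i _ =>
    Submodule.smul_mem _ _ (Submodule.subset_span ⟨i, rfl⟩)

theorem ONF.li {ι : Type*} [Fintype ι] {k : ℕ} {f : Fin k → ι → ℂ} (h : ONF f) :
    LinearIndependent ℂ f := by
  rw [Fintype.linearIndependent_iff]
  intro c hc i
  have e : ∑ x, star (f i x) * (∑ j, c j • f j) x = 0 := by rw [hc]; simp
  simp only [Finset.sum_apply, Pi.smul_apply, smul_eq_mul, Finset.mul_sum] at e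
  rw [Finset.sum_comm] at e
  have : ∀ j, ∑ x, star (f i x) * (c j * f j x) = c j * (if i = j then 1 else 0) := by
    intro j
    rw [← h i j, Finset.mul_sum]
    exact Finset.sum_congr rfl fun x _ => by ring
  rw [Finset.sum_congr rfl fun j _ => this j] at e
  simpa using e

theorem exists_ONF {ι : Type*} [Fintype ι] (W : Submodule ℂ (ι → ℂ)) (k : ℕ)
    (hk : Module.finrank ℂ W = k) :
    ∃ f : Fin k → ι → ℂ, ONF f ∧ (∀ i, f i ∈ W) ∧ ∀ x ∈ W, SpanMem f x := by
  classical
  let e : EuclideanSpace ℂ ι ≃ₗ[ℂ] (ι → ℂ) := WithLp.linearEquiv 2 ℂ (ι → ℂ)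
  let W' : Submodule ℂ (EuclideanSpace ℂ ι) := W.comap e.toLinearMap
  have hk' : Module.finrank ℂ W' = k := by
    rw [← hk]
    exact LinearEquiv.finrank_eq (e.ofSubmodule' W)
  let b := (stdOrthonormalBasis ℂ W').reindex (finCongr hk')
  have hin : ∀ x y : EuclideanSpace ℂ ι, inner ℂ x y = ∑ z, star (e x z) * e y z := by
    intro x y
    rw [PiLp.inner_apply]
    refine Finset.sum_congr rfl fun z _ => ?_
    rw [RCLike.inner_apply]
    simp [e, mul_comm]
  refine ⟨fun i => e (b i), ?_, fun i => (b i).2, ?_⟩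
  · intro i j
    rw [← hin]
    have := orthonormal_iff_ite.mp b.orthonormal i j
    simpa using this
  · intro x hx
    have hx' : e.symm x ∈ W' := by simpa [W'] using hx
    have := b.sum_repr' ⟨e.symm x, hx'⟩
    have h2 := congrArg (fun y : W' => e (y : EuclideanSpace ℂ ι)) this
    simp only [Submodule.coe_sum, Submodule.coe_smul, map_sum, map_smul,
      LinearEquiv.apply_symm_apply, Submodule.coe_inner] at h2
    unfold SpanMem
    conv_lhs => rw [← h2]
    refine Finset.sum_congr rfl fun i _ => ?_
    rw [hin]
    simp

theorem isCompact_ONF {ι : Type*} [Fintype ι] (k : ℕ) :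
    IsCompact {f : Fin k → ι → ℂ | ONF f} := by
  apply Metric.isCompact_of_isClosed_isBounded
  · simp only [ONF, Set.ofPred_forall]
    refine isClosed_iInter fun i => isClosed_iInter fun j => ?_
    exact isClosed_eq (by fun_prop) continuous_const
  · rw [isBounded_iff_forall_norm_le]
    refine ⟨1, fun f hf => ?_⟩
    rw [pi_norm_le_iff_of_nonneg zero_le_one]
    intro i
    rw [pi_norm_le_iff_of_nonneg zero_le_one]
    intro x
    have h := hf i i
    have h2 : ∑ x, ‖f i x‖ ^ 2 = 1 := by
      have : ((∑ x, ‖f i x‖ ^ 2 : ℝ) : ℂ) = 1 := by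
        rw [if_pos rfl] at h
        rw [← h]
        push_cast
        refine Finset.sum_congr rfl fun y _ => ?_
        have := Complex.conj_mul' (f i y)
        rw [← this]; rfl
      exact_mod_cast this
    have h3 : ‖f i x‖ ^ 2 ≤ ∑ x, ‖f i x‖ ^ 2 :=
      Finset.single_le_sum (f := fun x => ‖f i x‖ ^ 2) (fun y _ => by positivity)
        (Finset.mem_univ x)
    rw [h2] at h3
    nlinarith [norm_nonneg (f i x)]

/-- The index type of the matrix spaces. -/
abbrev II := Fin 2 × Fin 2

/-- The closed relation between a tensor and frames of the (110), (210), (120) pieces. -/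
def GoodData (k : ℕ) (T : II → II → II → ℂ) (f : Fin k → II × II → ℂ)
    (g h : Fin k → II × (II × II) → ℂ) : Prop :=
  (∀ c, SpanMem f (fun p => T p.1 p.2 c)) ∧
  (∀ i a, SpanMem f (fun p => g i (a, p))) ∧
  (∀ i a a' b, g i (a, (a', b)) = g i (a', (a, b))) ∧
  (∀ i b, SpanMem f (fun p => h i (b, p))) ∧
  (∀ i b a b', h i (b, (a, b')) = h i (b', (a, b)))

theorem isClosed_good (k : ℕ) :
    IsClosed {T : II → II → II → ℂ | ∃ f g h, ONF f ∧ ONF g ∧ ONF h ∧ GoodData k T f g h} := by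
  let K1 := {f : Fin k → II × II → ℂ | ONF f}
  let K2 := {f : Fin k → II × (II × II) → ℂ | ONF f}
  haveI : CompactSpace K1 := isCompact_iff_compactSpace.mp (isCompact_ONF k)
  haveI : CompactSpace K2 := isCompact_iff_compactSpace.mp (isCompact_ONF k)
  let Z : Set ((II → II → II → ℂ) × (K1 × K2 × K2)) :=
    {q | GoodData k q.1 q.2.1.1 q.2.2.1.1 q.2.2.2.1}
  have hZ' : IsClosed {q : (II → II → II → ℂ) × ((Fin k → II × II → ℂ) ×
      (Fin k → II × (II × II) → ℂ) × (Fin k → II × (II × II) → ℂ)) |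
      GoodData k q.1 q.2.1 q.2.2.1 q.2.2.2} := by
    simp only [GoodData, SpanMem, Set.ofPred_and, Set.ofPred_forall]
    refine IsClosed.inter ?_ (IsClosed.inter ?_ (IsClosed.inter ?_ (IsClosed.inter ?_ ?_)))
    · refine isClosed_iInter fun c => isClosed_eq (by fun_prop) (by fun_prop)
    · refine isClosed_iInter fun i => isClosed_iInter fun a =>
        isClosed_eq (by fun_prop) (by fun_prop)
    · refine isClosed_iInter fun i => isClosed_iInter fun a => isClosed_iInter fun a' =>
        isClosed_iInter fun b => isClosed_eq (by fun_prop) (by fun_prop)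
    · refine isClosed_iInter fun i => isClosed_iInter fun a =>
        isClosed_eq (by fun_prop) (by fun_prop)
    · refine isClosed_iInter fun i => isClosed_iInter fun a => isClosed_iInter fun a' =>
        isClosed_iInter fun b => isClosed_eq (by fun_prop) (by fun_prop)
  have hZ : IsClosed Z := by
    have hc : Continuous fun q : (II → II → II → ℂ) × (K1 × K2 × K2) =>
        (q.1, (q.2.1.1, q.2.2.1.1, q.2.2.2.1)) := by fun_prop
    exact hZ'.preimage hc
  have := isClosedMap_fst_of_compactSpace _ hZ
  convert this using 1
  ext T
  constructor
  · rintro ⟨f, g, h, hf, hg, hh, H⟩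
    exact ⟨⟨T, ⟨f, hf⟩, ⟨g, hg⟩, ⟨h, hh⟩⟩, H, rfl⟩
  · rintro ⟨⟨T', ⟨f, hf⟩, ⟨g, hg⟩, ⟨h, hh⟩⟩, H, rfl⟩
    exact ⟨f, g, h, hf, hg, hh, H⟩

theorem good_of_rankLE (T : II → II → II → ℂ) (r : ℕ) (hT : rankLE T r) :
    ∃ k ≤ r, ∃ f g h, ONF f ∧ ONF g ∧ ONF h ∧ GoodData k T f g h := by
  obtain ⟨u, v, w, rfl⟩ := hT
  let φ : Fin r → II × II → ℂ := fun l p => u l p.1 * v l p.2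
  obtain ⟨κ, s, hs, hspan, hli⟩ := exists_linearIndependent' ℂ φ
  haveI : Fintype κ := Fintype.ofInjective s hs
  let γ : κ → II × (II × II) → ℂ := fun l p => u (s l) p.1 * (u (s l) p.2.1 * v (s l) p.2.2)
  let δ : κ → II × (II × II) → ℂ := fun l p => v (s l) p.1 * (u (s l) p.2.1 * v (s l) p.2.2)
  have hu : ∀ l : κ, u (s l) ≠ 0 := fun l h0 =>
    hli.ne_zero l (by ext p; simp [φ, h0])
  have hv : ∀ l : κ, v (s l) ≠ 0 := fun l h0 =>
    hli.ne_zero l (by ext p; simp [φ, h0])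
  have hγ : LinearIndependent ℂ γ := by
    rw [Fintype.linearIndependent_iff] at hli ⊢
    intro c hc l
    by_contra hcl
    apply hu l
    ext a
    have := hli (fun l => c l * u (s l) a) (by
      ext p
      have := congrFun hc (a, p)
      simp [γ] at this
      simp [φ, ← this, mul_assoc]) l
    simpa [hcl] using this
  have hδ : LinearIndependent ℂ δ := by
    rw [Fintype.linearIndependent_iff] at hli ⊢
    intro c hc l
    by_contra hcl
    apply hv l
    ext a
    have := hli (fun l => c l * v (s l) a) (by
      ext p
      have := congrFun hc (a, p)
      simp [δ] at this
      simp [φ, ← this, mul_assoc]) l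
    simpa [hcl] using this
  have hkr : Fintype.card κ ≤ r := by
    simpa using Fintype.card_le_of_injective s hs
  obtain ⟨f, hf, hfm, hfs⟩ := exists_ONF (Submodule.span ℂ (Set.range (φ ∘ s))) _
    (finrank_span_eq_card hli)
  obtain ⟨g, hg, hgm, -⟩ := exists_ONF (Submodule.span ℂ (Set.range γ)) _
    (finrank_span_eq_card hγ)
  obtain ⟨h, hh, hhm, -⟩ := exists_ONF (Submodule.span ℂ (Set.range δ)) _
    (finrank_span_eq_card hδ)
  refine ⟨_, hkr, f, g, h, hf, hg, hh, ?_, ?_, ?_, ?_, ?_⟩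
  · intro c
    apply hfs
    rw [hspan]
    have : (fun p : II × II => ∑ l, u l p.1 * v l p.2 * w l c) = ∑ l, w l c • φ l := by
      ext p
      simp [φ, mul_comm]
    rw [this]
    exact Submodule.sum_mem _ fun i _ =>
      Submodule.smul_mem _ _ (Submodule.subset_span ⟨i, rfl⟩)
  · intro i a
    apply hfs
    obtain ⟨c, hc⟩ := (Submodule.mem_span_range_iff_exists_fun ℂ).mp (hgm i)
    have : (fun p : II × II => g i (a, p)) = ∑ l, (c l * u (s l) a) • (φ ∘ s) l := by
      ext p
      simp [φ, ← hc, γ, mul_assoc]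
    rw [this]
    exact Submodule.sum_mem _ fun i _ =>
      Submodule.smul_mem _ _ (Submodule.subset_span ⟨i, rfl⟩)
  · intro i a a' b
    obtain ⟨c, hc⟩ := (Submodule.mem_span_range_iff_exists_fun ℂ).mp (hgm i)
    rw [← hc]
    simp only [Finset.sum_apply, Pi.smul_apply, smul_eq_mul, γ]
    exact Finset.sum_congr rfl fun l _ => by ring
  · intro i a
    apply hfs
    obtain ⟨c, hc⟩ := (Submodule.mem_span_range_iff_exists_fun ℂ).mp (hhm i)
    have : (fun p : II × II => h i (a, p)) = ∑ l, (c l * v (s l) a) • (φ ∘ s) l := by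
      ext p
      simp [φ, ← hc, δ, mul_assoc]
    rw [this]
    exact Submodule.sum_mem _ fun i _ =>
      Submodule.smul_mem _ _ (Submodule.subset_span ⟨i, rfl⟩)
  · intro i a a' b
    obtain ⟨c, hc⟩ := (Submodule.mem_span_range_iff_exists_fun ℂ).mp (hhm i)
    rw [← hc]
    simp only [Finset.sum_apply, Pi.smul_apply, smul_eq_mul, δ]
    exact Finset.sum_congr rfl fun l _ => by ring

/-- Dimension count: a map on `II → F` killing an independent family of size `k + 16`. -/
theorem finrank_range_le {F N : Type*} [AddCommGroup F] [Module ℂ F] [FiniteDimensional ℂ F]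
    [AddCommGroup N] [Module ℂ N] {k : ℕ} (hF : Module.finrank ℂ F = k)
    (Φ : (II → F) →ₗ[ℂ] N) (e : Fin k ⊕ (II × II) → II → F) (he : LinearIndependent ℂ e)
    (h0 : ∀ i, Φ (e i) = 0) :
    Module.finrank ℂ (LinearMap.range Φ) + k + 16 ≤ 4 * k := by
  have h1 := LinearMap.finrank_range_add_finrank_ker Φ
  have h2 : Submodule.span ℂ (Set.range e) ≤ LinearMap.ker Φ := by
    rw [Submodule.span_le]
    rintro _ ⟨i, rfl⟩
    exact h0 i
  have h3 := Submodule.finrank_mono h2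
  rw [finrank_span_eq_card he] at h3
  simp [Module.finrank_pi_fintype, hF] at h1 h3
  omega

/-- The slice of the matrix multiplication tensor. -/
def mslice (c : II) : II × II → ℂ := fun p => matMulTensor 2 2 2 p.1 p.2 c

theorem indepA {k : ℕ} (g : Fin k → II × (II × II) → ℂ) (hg : LinearIndependent ℂ g)
    (hs : ∀ i a a' b, g i (a, (a', b)) = g i (a', (a, b)))
    (c : Fin k → ℂ) (d : II × II → ℂ)
    (h : ∀ a p, ∑ i, c i * g i (a, p) + ∑ z, d (a, z) * mslice z p = 0) :
    c = 0 ∧ d = 0 := by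
  have hm : ∀ a (p : II × II), ∑ z, d (a, z) * mslice z p =
      if p.1.2 = p.2.1 then d (a, (p.2.2, p.1.1)) else 0 := by
    rintro a ⟨⟨p, q⟩, r, s⟩
    rw [Finset.sum_eq_single (s, p)]
    · simp [mslice, matMulTensor]
    · rintro ⟨z1, z2⟩ - hz
      have : ¬ (q = r ∧ s = z1 ∧ z2 = p) := by
        rintro ⟨-, rfl, rfl⟩; exact hz rfl
      simp [mslice, matMulTensor, this]
    · simp
  simp only [hm] at h
  have hd : d = 0 := by
    ext ⟨⟨u, v⟩, w, u'⟩
    obtain ⟨v', hv'⟩ : ∃ v' : Fin 2, v' ≠ v := exists_ne v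
    have e1 := h (u, v) ((u', v'), (v', w))
    have e2 := h (u', v') ((u, v), (v', w))
    simp only [hs _ (u', v') (u, v) (v', w)] at e2
    rw [if_pos rfl] at e1
    rw [if_neg (by simpa using hv'.symm)] at e2
    simp only [Pi.zero_apply]
    linear_combination e1 - e2
  refine ⟨?_, hd⟩
  rw [Fintype.linearIndependent_iff] at hg
  ext i
  refine hg c ?_ i
  ext ⟨a, p⟩
  simpa [hd] using h a p

theorem indepB {k : ℕ} (g : Fin k → II × (II × II) → ℂ) (hg : LinearIndependent ℂ g)
    (hs : ∀ i b a b', g i (b, (a, b')) = g i (b', (a, b)))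
    (c : Fin k → ℂ) (d : II × II → ℂ)
    (h : ∀ a p, ∑ i, c i * g i (a, p) + ∑ z, d (a, z) * mslice z p = 0) :
    c = 0 ∧ d = 0 := by
  have hm : ∀ a (p : II × II), ∑ z, d (a, z) * mslice z p =
      if p.1.2 = p.2.1 then d (a, (p.2.2, p.1.1)) else 0 := by
    rintro a ⟨⟨p, q⟩, r, s⟩
    rw [Finset.sum_eq_single (s, p)]
    · simp [mslice, matMulTensor]
    · rintro ⟨z1, z2⟩ - hz
      have : ¬ (q = r ∧ s = z1 ∧ z2 = p) := by
        rintro ⟨-, rfl, rfl⟩; exact hz rfl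
      simp [mslice, matMulTensor, this]
    · simp
  simp only [hm] at h
  have hd : d = 0 := by
    ext ⟨⟨v, w⟩, w', u'⟩
    obtain ⟨v', hv'⟩ : ∃ v' : Fin 2, v' ≠ v := exists_ne v
    have e1 := h (v, w) ((u', v'), (v', w'))
    have e2 := h (v', w') ((u', v'), (v, w))
    simp only [hs _ (v', w') (u', v') (v, w)] at e2
    rw [if_pos rfl] at e1
    rw [if_neg (by simpa using hv')] at e2
    simp only [Pi.zero_apply]
    linear_combination e1 - e2
  refine ⟨?_, hd⟩
  rw [Fintype.linearIndependent_iff] at hg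
  ext i
  refine hg c ?_ i
  ext ⟨a, p⟩
  simpa [hd] using h a p

/-- The kernel family is independent, given the abstract independence statement. -/
theorem indep_family {k : ℕ} (F : Submodule ℂ (II × II → ℂ)) (g : Fin k → II × (II × II) → ℂ)
    (hgF : ∀ i a, (fun p => g i (a, p)) ∈ F) (hmF : ∀ c, mslice c ∈ F)
    (H : ∀ (c : Fin k → ℂ) (d : II × II → ℂ),
      (∀ a p, ∑ i, c i * g i (a, p) + ∑ z, d (a, z) * mslice z p = 0) → c = 0 ∧ d = 0) :
    LinearIndependent ℂ (Sum.elim (fun i a => (⟨_, hgF i a⟩ : F))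
      (fun z : II × II => Pi.single z.1 (⟨_, hmF z.2⟩ : F)) : Fin k ⊕ (II × II) → II → F) := by
  rw [Fintype.linearIndependent_iff]
  intro c hc
  have := H (fun i => c (Sum.inl i)) (fun z => c (Sum.inr z)) (by
    intro a p
    have e := congrArg (fun x : II → F => (x a : II × II → ℂ) p) hc
    simp only [Fintype.sum_sum_type, Sum.elim_inl, Sum.elim_inr, Pi.add_apply, Finset.sum_apply,
      Pi.smul_apply, Submodule.coe_add, Submodule.coe_sum, Submodule.coe_smul, smul_eq_mul,
      Pi.zero_apply, Submodule.coe_zero] at e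
    rw [← e]
    congr 1
    symm
    rw [Fintype.sum_prod_type, Finset.sum_eq_single a]
    · simp
    · intro b _ hb
      simp [Pi.single_eq_of_ne hb.symm]
    · simp)
  rintro (i | z)
  · exact congrFun this.1 i
  · exact congrFun this.2 z

open Polynomial in
/-- The traceless part, as a (dehomogenised) quadratic form. -/
def qq (u w : Fin 2) : (II × II → ℂ) →ₗ[ℂ] ℂ[X] :=
  let e : II × II → ((II × II → ℂ) →ₗ[ℂ] ℂ) := fun p => LinearMap.proj p
  (Polynomial.monomial 0) ∘ₗ e ((u, 0), (1, w)) +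
  (Polynomial.monomial 1) ∘ₗ (e ((u, 1), (1, w)) - e ((u, 0), (0, w))) -
  (Polynomial.monomial 2) ∘ₗ e ((u, 1), (0, w))

open Polynomial in
theorem qq_apply (u w : Fin 2) (x : II × II → ℂ) :
    qq u w x = C (x ((u, 0), (1, w))) +
      (C (x ((u, 1), (1, w))) - C (x ((u, 0), (0, w)))) * X - C (x ((u, 1), (0, w))) * X ^ 2 := by
  simp [qq, ← C_mul_X_pow_eq_monomial, sub_mul]

theorem qq_mslice (u w : Fin 2) (c : II) : qq u w (mslice c) = 0 := by
  simp [qq_apply, mslice, matMulTensor]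

theorem qq_ker (x : II × II → ℂ) (h : ∀ u w, qq u w x = 0) :
    x ∈ Submodule.span ℂ (Set.range mslice) := by
  rw [Submodule.mem_span_range_iff_exists_fun]
  refine ⟨fun c => x ((c.2, 0), (0, c.1)), ?_⟩
  have h0 : ∀ u w, x ((u, 0), (1, w)) = 0 ∧ x ((u, 1), (1, w)) = x ((u, 0), (0, w)) ∧
      x ((u, 1), (0, w)) = 0 := by
    intro u w
    have e := h u w
    rw [qq_apply] at e
    have c0 := congrArg (fun q => Polynomial.coeff q 0) e
    have c1 := congrArg (fun q => Polynomial.coeff q 1) e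
    have c2 := congrArg (fun q => Polynomial.coeff q 2) e
    simp [Polynomial.coeff_X, Polynomial.coeff_C, sub_mul, Polynomial.coeff_X_pow] at c0 c1 c2
    exact ⟨c0, by linear_combination c1, c2⟩
  ext ⟨⟨u, v⟩, v', w⟩
  have := h0 u w
  simp only [Finset.sum_apply, Pi.smul_apply, smul_eq_mul, mslice, matMulTensor,
    Fintype.sum_prod_type, Fin.sum_univ_two]
  fin_cases u <;> fin_cases v <;> fin_cases v' <;> fin_cases w <;> simp_all

open Polynomial in
/-- The (210) map. -/
def PhiA (F : Submodule ℂ (II × II → ℂ)) : (II → F) →ₗ[ℂ] (Fin 2 → ℂ[X]) :=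
  LinearMap.pi fun w => ∑ v : Fin 2, (LinearMap.mulLeft ℂ ((X : ℂ[X]) ^ (v : ℕ))) ∘ₗ
    ((qq 1 w) ∘ₗ F.subtype ∘ₗ LinearMap.proj (0, v) -
      (qq 0 w) ∘ₗ F.subtype ∘ₗ LinearMap.proj (1, v))

open Polynomial in
theorem PhiA_apply (F : Submodule ℂ (II × II → ℂ)) (x : II → F) (w : Fin 2) :
    PhiA F x w = (qq 1 w (x (0, 0)) - qq 0 w (x (1, 0))) +
      X * (qq 1 w (x (0, 1)) - qq 0 w (x (1, 1))) := by
  simp [PhiA, Fin.sum_univ_two]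

open Polynomial in
/-- The (120) map. -/
def PhiB (F : Submodule ℂ (II × II → ℂ)) : (II → F) →ₗ[ℂ] (Fin 2 → ℂ[X]) :=
  LinearMap.pi fun u => ∑ v : Fin 2, (LinearMap.mulLeft ℂ (if v = 0 then -(X : ℂ[X]) else 1)) ∘ₗ
    ((qq u 1) ∘ₗ F.subtype ∘ₗ LinearMap.proj (v, 0) -
      (qq u 0) ∘ₗ F.subtype ∘ₗ LinearMap.proj (v, 1))

open Polynomial in
theorem PhiB_apply (F : Submodule ℂ (II × II → ℂ)) (x : II → F) (u : Fin 2) :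
    PhiB F x u = -X * (qq u 1 (x (0, 0)) - qq u 0 (x (0, 1))) +
      (qq u 1 (x (1, 0)) - qq u 0 (x (1, 1))) := by
  simp [PhiB, Fin.sum_univ_two]

theorem two_cases (u : Fin 2) : u = 0 ∨ u = 1 := by fin_cases u <;> simp

open Polynomial in
theorem core (k : ℕ) (hk : k ≤ 6) (f : Fin k → II × II → ℂ) (g h : Fin k → II × (II × II) → ℂ)
    (hf : ONF f) (hg : ONF g) (hh : ONF h)
    (H : GoodData k (matMulTensor 2 2 2) f g h) : False := by
  obtain ⟨H1, H2, H3, H4, H5⟩ := H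
  set F := Submodule.span ℂ (Set.range f) with hFdef
  have hF : Module.finrank ℂ F = k := by
    rw [hFdef, finrank_span_eq_card hf.li]; simp
  have hmF : ∀ c, mslice c ∈ F := fun c => (H1 c).mem
  have hgF : ∀ i a, (fun p => g i (a, p)) ∈ F := fun i a => (H2 i a).mem
  have hhF : ∀ i a, (fun p => h i (a, p)) ∈ F := fun i a => (H4 i a).mem
  have rA := finrank_range_le hF (PhiA F) _
    (indep_family F g hgF hmF (indepA g hg.li H3)) (by
      rintro (i | ⟨a, c⟩)
      · ext1 w
        simp only [Sum.elim_inl, PhiA_apply, qq_apply]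
        rw [H3 i (1, 0) (0, 0) (1, w), H3 i (1, 0) (0, 1) (1, w), H3 i (1, 0) (0, 0) (0, w),
          H3 i (1, 0) (0, 1) (0, w), H3 i (1, 1) (0, 0) (1, w), H3 i (1, 1) (0, 1) (1, w),
          H3 i (1, 1) (0, 0) (0, w), H3 i (1, 1) (0, 1) (0, w)]
        simp only [Pi.zero_apply]
        ring
      · ext1 w
        have : ∀ u b, qq u w (((Pi.single a (⟨_, hmF c⟩ : F) : II → F) b : F) : II × II → ℂ) = 0 := by
          intro u b
          by_cases hb : b = a
          · subst hb; simp [qq_mslice]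
          · simp [Pi.single_eq_of_ne hb]
        simp [Sum.elim_inr, PhiA_apply, this])
  have rB := finrank_range_le hF (PhiB F) _
    (indep_family F h hhF hmF (indepB h hh.li H5)) (by
      rintro (i | ⟨a, c⟩)
      · ext1 u
        simp only [Sum.elim_inl, PhiB_apply, qq_apply]
        rw [H5 i (0, 1) (u, 0) (0, 0), H5 i (0, 1) (u, 1) (0, 0), H5 i (0, 1) (u, 0) (1, 0),
          H5 i (0, 1) (u, 1) (1, 0), H5 i (1, 1) (u, 0) (0, 0), H5 i (1, 1) (u, 1) (0, 0),
          H5 i (1, 1) (u, 0) (1, 0), H5 i (1, 1) (u, 1) (1, 0)]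
        simp only [Pi.zero_apply]
        ring
      · ext1 u
        have : ∀ w b, qq u w (((Pi.single a (⟨_, hmF c⟩ : F) : II → F) b : F) : II × II → ℂ) = 0 := by
          intro u b
          by_cases hb : b = a
          · subst hb; simp [qq_mslice]
          · simp [Pi.single_eq_of_ne hb]
        simp [Sum.elim_inr, PhiB_apply, this])
  have hk6 : k = 6 := by omega
  obtain ⟨p₀, hp₀⟩ := aux_span_one (LinearMap.range (PhiA F)) (by omega)
    {p | ∃ x : F, ∃ u, p = fun w => qq u w x} (by
      rintro _ ⟨x, u, rfl⟩
      rcases two_cases u with rfl | rfl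
      · refine ⟨Pi.single (1, 0) (-x), ?_⟩
        ext1 w
        simp [PhiA_apply, Pi.single_apply]
      · refine ⟨Pi.single (0, 0) x, ?_⟩
        ext1 w
        simp [PhiA_apply, Pi.single_apply]) (by
      rintro _ ⟨x, u, rfl⟩
      rcases two_cases u with rfl | rfl
      · refine ⟨Pi.single (1, 1) (-x), ?_⟩
        ext1 w
        simp [PhiA_apply, Pi.single_apply]
      · refine ⟨Pi.single (0, 1) x, ?_⟩
        ext1 w
        simp [PhiA_apply, Pi.single_apply])
  obtain ⟨r₀, hr₀⟩ := aux_span_one (LinearMap.range (PhiB F)) (by omega)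
    {p | ∃ x : F, ∃ w, p = fun u => qq u w x} (by
      rintro _ ⟨x, u, rfl⟩
      rcases two_cases u with rfl | rfl
      · refine ⟨Pi.single (1, 1) (-x), ?_⟩
        ext1 w
        simp [PhiB_apply, Pi.single_apply]
      · refine ⟨Pi.single (1, 0) x, ?_⟩
        ext1 w
        simp [PhiB_apply, Pi.single_apply]) (by
      rintro _ ⟨x, u, rfl⟩
      rcases two_cases u with rfl | rfl
      · refine ⟨Pi.single (0, 1) x, ?_⟩
        ext1 w
        simp [PhiB_apply, Pi.single_apply]
      · refine ⟨Pi.single (0, 0) (-x), ?_⟩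
        ext1 w
        simp [PhiB_apply, Pi.single_apply])
  have ha : ∀ x : F, ∀ u, ∃ c : ℂ, ∀ w, qq u w x = C c * p₀ w := by
    intro x u
    obtain ⟨c, hc⟩ := hp₀ _ ⟨x, u, rfl⟩
    exact ⟨c, fun w => by simpa [smul_eq_C_mul] using congrFun hc w⟩
  have hb : ∀ x : F, ∀ w, ∃ c : ℂ, ∀ u, qq u w x = C c * r₀ u := by
    intro x w
    obtain ⟨c, hc⟩ := hr₀ _ ⟨x, w, rfl⟩
    exact ⟨c, fun u => by simpa [smul_eq_C_mul] using congrFun hc u⟩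
  -- every two elements of `F` are dependent modulo the kernel of `qq`
  have hdep : ∃ y₀ : F, ∀ x : F, ∃ c : ℂ, ∀ u w, qq u w (x - c • y₀ : II × II → ℂ) = 0 := by
    by_cases hall : ∀ x : F, ∀ u w, qq u w x = 0
    · exact ⟨0, fun x => ⟨0, fun u w => by simpa using hall x u w⟩⟩
    push Not at hall
    obtain ⟨y₀, u₀, w₀, hy⟩ := hall
    obtain ⟨b₀, hb₀⟩ := hb y₀ w₀
    have hb0 : b₀ ≠ 0 := by
      rintro rfl
      apply hy
      simp [hb₀]
    have hpw : p₀ w₀ ≠ 0 := by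
      intro h0
      obtain ⟨c, hc⟩ := ha y₀ u₀
      apply hy
      simp [hc, h0]
    refine ⟨y₀, fun x => ?_⟩
    obtain ⟨b, hbx⟩ := hb x w₀
    refine ⟨b / b₀, fun u w => ?_⟩
    obtain ⟨c, hc⟩ := ha (x - (b / b₀) • y₀) u
    have e1 : qq u w₀ (x - (b / b₀) • y₀ : II × II → ℂ) = 0 := by
      rw [map_sub, map_smul, hbx, hb₀, smul_eq_C_mul, ← mul_assoc, ← C_mul,
        div_mul_cancel₀ _ hb0, sub_self]
    have e2 := hc w₀
    have e3 := hc w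
    simp only [Submodule.coe_sub, Submodule.coe_smul] at e2 e3
    rw [e1] at e2
    have : C c = 0 := (mul_eq_zero.mp e2.symm).resolve_right hpw
    rw [e3, this, zero_mul]
  obtain ⟨y₀, hy₀⟩ := hdep
  have hle : F ≤ Submodule.span ℂ (Set.range mslice) ⊔ Submodule.span ℂ {(y₀ : II × II → ℂ)} := by
    intro x hx
    obtain ⟨c, hc⟩ := hy₀ ⟨x, hx⟩
    rw [Submodule.mem_sup]
    refine ⟨x - c • (y₀ : II × II → ℂ), qq_ker _ hc, c • (y₀ : II × II → ℂ), ?_, by simp⟩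
    exact Submodule.smul_mem _ _ (Submodule.mem_span_singleton_self _)
  have h1 := Submodule.finrank_mono hle
  have h2 := Submodule.finrank_add_le_finrank_add_finrank
    (Submodule.span ℂ (Set.range mslice)) (Submodule.span ℂ {(y₀ : II × II → ℂ)})
  have h3 : Module.finrank ℂ (Submodule.span ℂ (Set.range mslice)) ≤ 4 := by
    exact finrank_range_le_card (R := ℂ) mslice
  have h4 : Module.finrank ℂ (Submodule.span ℂ {(y₀ : II × II → ℂ)}) ≤ 1 := by
    have := finrank_span_le_card (R := ℂ) ({(y₀ : II × II → ℂ)} : Set (II × II → ℂ))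
    simpa using this
  omega

theorem strassen : rankLE (matMulTensor 2 2 2) 7 := by
  refine ⟨fun l x => (![!![1, 0; 0, 1], !![0, 0; 1, 1], !![1, 0; 0, 0], !![0, 0; 0, 1],
      !![1, 1; 0, 0], !![-1, 0; 1, 0], !![0, 1; 0, -1]] l : Matrix (Fin 2) (Fin 2) ℂ) x.1 x.2,
    fun l x => (![!![1, 0; 0, 1], !![1, 0; 0, 0], !![0, 1; 0, -1], !![-1, 0; 1, 0],
      !![0, 0; 0, 1], !![1, 1; 0, 0], !![0, 0; 1, 1]] l : Matrix (Fin 2) (Fin 2) ℂ) x.1 x.2,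
    fun l x => (![!![1, 0; 0, 1], !![0, 0; 1, -1], !![0, 1; 0, 1], !![1, 0; 1, 0],
      !![-1, 1; 0, 0], !![0, 0; 0, 1], !![1, 0; 0, 0]] l : Matrix (Fin 2) (Fin 2) ℂ) x.2 x.1,
    ?_⟩
  ext ⟨a, b⟩ ⟨c, d⟩ ⟨e, f⟩
  fin_cases a <;> fin_cases b <;> fin_cases c <;> fin_cases d <;> fin_cases e <;> fin_cases f <;>
    simp [matMulTensor, Fin.sum_univ_succ]

/-- `BR(M⟨2⟩) = 7`. -/
theorem borderRank_matMul_two :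
    brank (matMulTensor 2 2 2) = 7 := by
  have h7 : 7 ∈ {r | matMulTensor 2 2 2 ∈ closure {S : II → II → II → ℂ | rankLE S r}} :=
    subset_closure strassen
  apply le_antisymm
  · exact Nat.sInf_le h7
  · apply le_csInf ⟨7, h7⟩
    intro r hr
    by_contra hlt
    have hr6 : r ≤ 6 := by omega
    have hcl : IsClosed (⋃ k ∈ Finset.range 7,
        {T : II → II → II → ℂ | ∃ f g h, ONF f ∧ ONF g ∧ ONF h ∧ GoodData k T f g h}) :=
      isClosed_biUnion_finset fun k _ => isClosed_good k
    have hsub : {S : II → II → II → ℂ | rankLE S r} ⊆ ⋃ k ∈ Finset.range 7,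
        {T : II → II → II → ℂ | ∃ f g h, ONF f ∧ ONF g ∧ ONF h ∧ GoodData k T f g h} := by
      intro S hS
      obtain ⟨k, hk, H⟩ := good_of_rankLE S r hS
      simp only [Set.mem_iUnion]
      exact ⟨k, by simp; omega, H⟩
    have hmem := closure_minimal hsub hcl hr
    simp only [Set.mem_iUnion] at hmem
    obtain ⟨k, hk, f, g, h, hf, hg, hh, H⟩ := hmem
    exact core k (by simp at hk; omega) f g h hf hg hh H

end
end

section
/- Every homogeneous polynomial of degree at most 18 on ℂ⁴⊗ℂ⁴⊗ℂ⁴ (a polynomial in 64 variables, the coordinates with respect to the basis of simple tensors of standard basis vectors) that vanishes at every tensor of rank at most 6 in ℂ⁴⊗ℂ⁴⊗ℂ⁴ is the zero polynomial. Equivalently, the ideal of σ₆(Seg(ℙ³×ℙ³×ℙ³)) is empty in degrees less than 19. -/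
open scoped BigOperators

noncomputable section

namespace Sigma6

/-! ### Part 1: a verified linear independence computation -/

structure Row where
  k : ℕ
  p : ℕ

def force {α : Type} (n : ℕ) (f : ℕ → α) : α := Nat.rec (f 0) (fun k _ => f (Nat.succ k)) n

theorem force_eq {α : Type} (n : ℕ) (f : ℕ → α) : force n f = f n := by cases n <;> rfl

def red (B : List ℕ) (r : ℕ) : ℕ :=
  List.rec r (fun p _ r => cond (Nat.ble r (Nat.xor r p)) r (Nat.xor r p)) B

def elimOK (L : List Row) : List ℕ → Bool :=
  List.rec (fun _ => true)
    (fun p _ ih B => cond (Nat.beq (red B p.p) 0) false (ih (red B p.p :: B))) L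

def partn {α : Type} (b : ℕ) (L : List Row) (k : List Row → List Row → α) :
    List Row → List Row → α :=
  List.rec (fun X Y => k X Y)
   (fun r _ ih X Y => Nat.rec (ih (r :: X) Y) (fun _ _ => ih X (r :: Y)) (Nat.land r.k b)) L

def radix (ss : List ℕ) : List Row → Bool :=
  List.rec (fun L => elimOK L [])
    (fun s _ ih L => List.rec true (fun r t _ => List.rec (Nat.blt 0 r.p)
       (fun _ _ _ => partn s L (fun X Y => cond (ih X) (ih Y) false) [] []) t) L) ss

def gen (cs : List Row) : ℕ → Row → (Row → List Row → List Row) → List Row → List Row :=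
  List.rec (fun s r K acc => Nat.rec (K r acc) (fun _ _ => acc) s)
   (fun c _ ih s => Nat.rec (fun r K acc => K r acc)
     (fun n ihn r K acc =>
        Row.rec (fun rk rp => Row.rec (fun ck cp =>
          force (Nat.add rk ck) fun k => force (Nat.xor rp (Nat.shiftLeft rp cp)) fun p =>
            ihn (Row.mk k p) K (ih (Nat.succ n) r K acc)) c) r) s) cs

def block0 : List Row :=
  [⟨1073774593,35⟩, ⟨8589967361,34⟩, ⟨134479873,36⟩, ⟨8590196737,25⟩, ⟨136314881,37⟩, ⟨1075838977,27⟩]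

def block1 : List Row :=
  [⟨1073745928,29⟩, ⟨8589938696,28⟩, ⟨17039368,23⟩, ⟨8590196744,31⟩, ⟨18874376,24⟩, ⟨1075838984,33⟩]

def block2 : List Row :=
  [⟨134221888,24⟩, ⟨8589938752,13⟩, ⟨16810048,17⟩, ⟨8589967424,25⟩, ⟨18874432,9⟩, ⟨136314944,28⟩]

def block3 : List Row :=
  [⟨134222336,32⟩, ⟨1073746432,22⟩, ⟨16810496,25⟩, ⟨1073775104,34⟩, ⟨17039872,16⟩, ⟨134480384,35⟩]

def bitmasks : List ℕ :=
  [4096, 8192, 32768, 65536, 262144, 524288, 16777216, 33554432, 134217728, 268435456, 1073741824, 2147483648]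

def rowsOf (a b c d : ℕ) : List Row :=
  gen block0 a ⟨0,1⟩ (fun r => gen block1 b r
    (fun r => gen block2 c r fun r => gen block3 d r fun r l => r :: l)) []

def checkRows (a b c d : ℕ) : Bool := radix bitmasks (rowsOf a b c d)

set_option maxRecDepth 100000 in
theorem checkRows_all : checkRows 6 0 0 0 = true ∧ checkRows 5 1 0 0 = true ∧
    checkRows 4 2 0 0 = true ∧ checkRows 4 1 1 0 = true ∧ checkRows 3 3 0 0 = true ∧
    checkRows 3 2 1 0 = true ∧ checkRows 3 1 1 1 = true ∧ checkRows 2 2 2 0 = true ∧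
    checkRows 2 2 1 1 = true := by
  refine ⟨?_, ?_, ?_, ?_, ?_, ?_, ?_, ?_, ?_⟩ <;> decide +kernel

/-! ### Soundness of the elimination -/

theorem min_step (q x : ℕ) (hq : q ≠ 0) :
    cond (Nat.ble x (Nat.xor x q)) x (Nat.xor x q)
      = if x.testBit (Nat.log2 q) then x ^^^ q else x := by
  have hbit : q.testBit (Nat.log2 q) = true := Nat.testBit_log2 hq
  have hhi : ∀ j, Nat.log2 q < j → q.testBit j = false := fun j hj =>
    Nat.testBit_lt_two_pow (lt_of_lt_of_le (Nat.lt_log2_self) (Nat.pow_le_pow_right (by norm_num) hj))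
  change cond (Nat.ble x (x ^^^ q)) x (x ^^^ q) = _
  by_cases h : x.testBit (Nat.log2 q) = true
  · have : x ^^^ q < x := by
      apply Nat.lt_of_testBit (Nat.log2 q)
      · simp [Nat.testBit_xor, hbit, h]
      · exact h
      · intro j hj; simp [Nat.testBit_xor, hhi j hj]
    have h2 : Nat.ble x (x ^^^ q) = false := by
      rw [← Bool.not_eq_true, Nat.ble_eq]; omega
    simp [h, h2]
  · have : x < x ^^^ q := by
      apply Nat.lt_of_testBit (Nat.log2 q)
      · simpa using h
      · simp [Nat.testBit_xor, hbit, h]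
      · intro j hj; simp [Nat.testBit_xor, hhi j hj]
    have h2 : Nat.ble x (x ^^^ q) = true := by
      rw [Nat.ble_eq]; omega
    simp [h, h2]

theorem red_cons (q : ℕ) (B : List ℕ) (x : ℕ) (hq : q ≠ 0) :
    red (q :: B) x = if (red B x).testBit (Nat.log2 q) then red B x ^^^ q else red B x :=
  min_step q (red B x) hq

theorem red_xor (B : List ℕ) (hB : ∀ q ∈ B, q ≠ 0) (x y : ℕ) :
    red B (x ^^^ y) = red B x ^^^ red B y := by
  induction B with
  | nil => rfl
  | cons q B ih =>
    have ih := ih (fun q' h => hB q' (List.mem_cons_of_mem _ h))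
    rw [red_cons _ _ _ (hB q (by simp)), red_cons _ _ _ (hB q (by simp)),
      red_cons _ _ _ (hB q (by simp)), ih, Nat.testBit_xor]
    generalize red B x = s
    generalize red B y = t
    have h1 : s ^^^ t ^^^ q = s ^^^ (t ^^^ q) := Nat.xor_assoc _ _ _
    have h2 : s ^^^ t ^^^ q = s ^^^ q ^^^ t := by
      rw [Nat.xor_assoc, Nat.xor_comm t q, ← Nat.xor_assoc]
    have h3 : s ^^^ t = s ^^^ q ^^^ (t ^^^ q) := by
      rw [Nat.xor_comm t q, ← Nat.xor_assoc, Nat.xor_assoc s q q, Nat.xor_self, Nat.xor_zero]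
    cases s.testBit q.log2 <;> cases t.testBit q.log2
    · rfl
    · exact h1
    · exact h2
    · exact h3

def xorList (L : List Row) : ℕ := L.foldr (fun r x => r.p ^^^ x) 0

theorem elimOK_sound (L : List Row) : ∀ (B : List ℕ), (∀ q ∈ B, q ≠ 0) → elimOK L B = true →
    ∀ T, T.Sublist L → T ≠ [] → red B (xorList T) ≠ 0 := by
  induction L with
  | nil => intro B _ _ T hT hT0; exact absurd (List.sublist_nil.mp hT) hT0
  | cons p L ih =>
    intro B hB h T hT hT0
    have h' : cond (Nat.beq (red B p.p) 0) false (elimOK L (red B p.p :: B)) = true := h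
    have hq : red B p.p ≠ 0 := by
      intro h0; rw [h0] at h'; simp at h'
    have hb : Nat.beq (red B p.p) 0 = false := by
      rw [← Bool.not_eq_true, Nat.beq_eq]; exact hq
    rw [hb] at h'
    have ih' := ih (red B p.p :: B) (by
      intro q hq'; rcases List.mem_cons.mp hq' with rfl | h1
      · exact hq
      · exact hB _ h1) h'
    rcases List.sublist_cons_iff.mp hT with h1 | ⟨T', rfl, h1⟩
    · have := ih' T h1 hT0
      rw [red_cons _ _ _ hq] at this
      intro h0; rw [h0] at this; simp at this
    · have e : red B (xorList (p :: T')) = red B p.p ^^^ red B (xorList T') := by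
        rw [← red_xor B hB]; rfl
      rw [e]
      by_cases hT' : T' = []
      · subst hT'
        have : red B (xorList []) = 0 := by
          have := red_xor B hB 0 0
          simpa [xorList] using this
        rw [this]; simpa using hq
      · have := ih' T' h1 hT'
        rw [red_cons _ _ _ hq] at this
        intro h0
        have h3 := Nat.xor_eq_zero_iff.mp h0
        rw [← h3, Nat.testBit_log2 hq] at this
        simp at this

theorem xorList_testBit (T : List Row) (i : ℕ) :
    (xorList T).testBit i = true ↔ Odd (T.countP (fun r => r.p.testBit i)) := by
  induction T with
  | nil => simp [xorList]
  | cons r T ih =>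
    have : xorList (r :: T) = r.p ^^^ xorList T := rfl
    rw [this, Nat.testBit_xor, List.countP_cons]
    cases h : r.p.testBit i
    · simpa using ih
    · simp [Nat.odd_add_one, ← ih]

/-- Parity independence of a multiset of rows. -/
def Indep (M : Multiset Row) : Prop :=
  ∀ T ≤ M, T ≠ 0 → ∃ i, Odd (T.countP (fun r => r.p.testBit i = true))

theorem elimOK_indep (L : List Row) (h : elimOK L [] = true) : Indep (L : Multiset Row) := by
  intro T hT hT0
  induction T using Quotient.inductionOn with
  | _ l =>
  obtain ⟨l', hp, hs⟩ := Multiset.coe_le.mp hT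
  have hl' : l' ≠ [] := by
    rintro rfl
    apply hT0
    have := hp.symm.eq_nil
    subst this; rfl
  have h0 := elimOK_sound L [] (by simp) h l' hs hl'
  have h0 : xorList l' ≠ 0 := h0
  obtain ⟨i, hi⟩ := Nat.exists_testBit_of_ne_zero h0
  refine ⟨i, ?_⟩
  have := (xorList_testBit l' i).mp hi
  rw [hp.countP_eq] at this
  simpa using this

theorem partn_eq {α : Type} (b : ℕ) (L : List Row) (k : List Row → List Row → α) :
    ∀ X Y, partn b L k X Y = k ((L.filter fun r => decide (r.k &&& b = 0)).reverse ++ X)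
      ((L.filter fun r => decide (r.k &&& b ≠ 0)).reverse ++ Y) := by
  induction L with
  | nil => intro X Y; rfl
  | cons r L ih =>
    intro X Y
    have e : partn b (r :: L) k X Y = Nat.rec (partn b L k (r :: X) Y)
      (fun _ _ => partn b L k X (r :: Y)) (r.k &&& b) := rfl
    rw [e]
    rcases h : r.k &&& b with _ | n
    · simp [ih, h]
    · simp [ih, h]

theorem radix_sound (ss : List ℕ) : ∀ L, radix ss L = true → ∀ K,
    Indep ((L : Multiset Row).filter (fun r => r.k = K)) := by
  induction ss with
  | nil =>
    intro L h K T hT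
    exact elimOK_indep L h T (hT.trans (Multiset.filter_le _ _))
  | cons s ss ih =>
    intro L h K
    match L, h with
    | [], _ => intro T hT hT0; simp at hT; exact absurd hT hT0
    | [r], h =>
      have hr : 0 < r.p := by
        have : Nat.blt 0 r.p = true := h
        simpa [Nat.blt_eq] using this
      intro T hT hT0
      have h1 : T ≤ {r} := hT.trans (Multiset.filter_le _ _)
      have h2 : T = {r} := by
        rcases Multiset.le_singleton.mp h1 with h | h
        · exact absurd h hT0
        · exact h
      obtain ⟨i, hi⟩ := Nat.exists_testBit_of_ne_zero hr.ne'
      refine ⟨i, ?_⟩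
      rw [h2, show ({r} : Multiset Row) = r ::ₘ 0 from rfl, Multiset.countP_cons_of_pos (p := fun r : Row => r.p.testBit i = true) _ hi]
      simp
    | r :: r' :: t, h =>
      have e : radix (s :: ss) (r :: r' :: t) = partn s (r :: r' :: t)
        (fun X Y => cond (radix ss X) (radix ss Y) false) [] [] := rfl
      rw [e, partn_eq] at h
      generalize r :: r' :: t = L at h
      simp only [Bool.cond_false_right, Bool.and_eq_true, List.append_nil] at h
      intro T hT
      have hT1 : T ≤ L := hT.trans (Multiset.filter_le _ _)
      have hT2 : ∀ x ∈ T, x.k = K := fun x hx => (Multiset.mem_filter.mp (Multiset.mem_of_le hT hx)).2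
      by_cases hK : K &&& s = 0
      · apply ih _ h.1 K T
        rw [Multiset.le_filter]
        refine ⟨?_, hT2⟩
        rw [Multiset.coe_reverse, ← Multiset.filter_coe, Multiset.le_filter]
        exact ⟨hT1, fun x hx => by simp [hT2 x hx, hK]⟩
      · apply ih _ h.2 K T
        rw [Multiset.le_filter]
        refine ⟨?_, hT2⟩
        rw [Multiset.coe_reverse, ← Multiset.filter_coe, Multiset.le_filter]
        exact ⟨hT1, fun x hx => by simp [hT2 x hx, hK]⟩

/-! ### Enumeration of exponent vectors -/

abbrev Idx := Fin 4 × Fin 4 × Fin 4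

def genL {C R : Type} (op : C → R → R) : List C → ℕ → R → List R
  | [], 0, r => [r]
  | [], _ + 1, _ => []
  | _ :: _, 0, r => [r]
  | c :: cs, s + 1, r => genL op (c :: cs) s (op c r) ++ genL op cs (s + 1) r
  termination_by cs s _ => cs.length + s

def rowOp (c r : Row) : Row := ⟨r.k + c.k, r.p ^^^ (r.p <<< c.p)⟩

theorem gen_eq (cs : List Row) : ∀ s r K acc,
    gen cs s r K acc = (genL rowOp cs s r).foldr K acc := by
  induction cs with
  | nil =>
    intro s r K acc
    cases s <;> simp [genL] <;> rfl
  | cons c cs ih =>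
    intro s
    induction s with
    | zero => intro r K acc; simp [genL]; rfl
    | succ n ihn =>
      intro r K acc
      rw [genL, List.foldr_append, ← ih, ← ihn]
      obtain ⟨rk, rp⟩ := r
      obtain ⟨ck, cp⟩ := c
      have e : gen (⟨ck, cp⟩ :: cs) (n + 1) ⟨rk, rp⟩ K acc =
        (force (Nat.add rk ck) fun k => force (Nat.xor rp (Nat.shiftLeft rp cp)) fun p =>
            gen (⟨ck, cp⟩ :: cs) n (Row.mk k p) K (gen cs (Nat.succ n) ⟨rk, rp⟩ K acc)) := rfl
      rw [e, force_eq, force_eq]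
      rfl

def rowsL {C R : Type} (op : C → R → R) : List (List C × ℕ) → R → List R
  | [], r => [r]
  | b :: bs, r => (genL op b.1 b.2 r).flatMap (rowsL op bs)

theorem rowsOf_eq (a b c d : ℕ) : rowsOf a b c d =
    rowsL rowOp [(block0, a), (block1, b), (block2, c), (block3, d)] ⟨0, 1⟩ := by
  have key : ∀ (L : List Row) (f : Row → List Row) (acc : List Row),
      L.foldr (fun r l => f r ++ l) acc = L.flatMap f ++ acc := by
    intro L f acc
    induction L with
    | nil => rfl
    | cons r L ih => simp [ih]
  have gen_eq' : ∀ cs s r K, gen cs s r K = fun acc => (genL rowOp cs s r).foldr K acc :=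
    fun cs s r K => funext (gen_eq cs s r K)
  simp only [rowsOf, gen_eq', rowsL]
  have h0 : ∀ (L acc : List Row), L.foldr (fun r l => r :: l) acc = L.flatMap (fun r => [r]) ++ acc := by
    intro L acc
    induction L with
    | nil => rfl
    | cons r L ih => simp [ih]
  simp only [h0, key, List.append_nil]

theorem genL_rel {C R C' R' : Type} (op : C → R → R) (op' : C' → R' → R')
    (rc : C → C' → Prop) (rr : R → R' → Prop)
    (h : ∀ c c' r r', rc c c' → rr r r' → rr (op c r) (op' c' r')) :
    ∀ (cs : List C) (s : ℕ) (r : R) (cs' : List C') (r' : R'), List.Forall₂ rc cs cs' → rr r r' →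
      List.Forall₂ rr (genL op cs s r) (genL op' cs' s r')
  | [], 0, r, cs', r', hc, hr => by cases hc; simpa [genL] using hr
  | [], _ + 1, r, cs', r', hc, hr => by cases hc; simp [genL]
  | _ :: _, 0, r, cs', r', hc, hr => by cases hc; simpa [genL] using hr
  | c :: cs, s + 1, r, cs', r', hc, hr => by
    cases hc with
    | cons h1 h2 =>
      rw [genL, genL]
      exact List.rel_append (genL_rel op op' rc rr h _ _ _ _ _ (List.Forall₂.cons h1 h2) (h _ _ _ _ h1 hr))
        (genL_rel op op' rc rr h _ _ _ _ _ h2 hr)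
  termination_by cs s _ => cs.length + s

theorem rowsL_rel {C R C' R' : Type} (op : C → R → R) (op' : C' → R' → R')
    (rc : C → C' → Prop) (rr : R → R' → Prop)
    (h : ∀ c c' r r', rc c c' → rr r r' → rr (op c r) (op' c' r'))
    (bs : List (List C × ℕ)) : ∀ (bs' : List (List C' × ℕ)) (r : R) (r' : R'),
      List.Forall₂ (fun b b' => List.Forall₂ rc b.1 b'.1 ∧ b.2 = b'.2) bs bs' → rr r r' →
      List.Forall₂ rr (rowsL op bs r) (rowsL op' bs' r') := by
  induction bs with
  | nil => intro bs' r r' hb hr; cases hb; simpa [rowsL] using hr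
  | cons b bs ih =>
    intro bs' r r' hb hr
    cases hb with
    | cons h1 h2 =>
      rw [rowsL, rowsL]
      refine List.rel_flatMap (P := rr) (R := rr) ?_ ?_
      · rw [← h1.2]
        exact genL_rel op op' rc rr h _ _ _ _ _ h1.1 hr
      · intro x x' hx
        exact ih _ _ _ h2 hx

def absOp (c : Idx) (r : Idx →₀ ℕ) : Idx →₀ ℕ := r + Finsupp.single c 1

theorem genL_complete : ∀ (cs : List Idx) (s : ℕ) (r n : Idx →₀ ℕ),
    (∀ q, n q ≠ 0 → q ∈ cs) → n.degree = s → r + n ∈ genL absOp cs s r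
  | [], 0, r, n, h1, h2 => by
    have : n = 0 := (Finsupp.degree_eq_zero_iff n).mp h2
    simp [genL, this]
  | [], s + 1, r, n, h1, h2 => by
    exfalso
    have : n = 0 := by ext q; by_contra h; simpa using h1 q h
    simp [this] at h2
  | _ :: _, 0, r, n, h1, h2 => by
    have : n = 0 := (Finsupp.degree_eq_zero_iff n).mp h2
    simp [genL, this]
  | c :: cs, s + 1, r, n, h1, h2 => by
    rw [genL, List.mem_append]
    by_cases hc : n c = 0
    · right
      apply genL_complete cs (s + 1) r n _ h2
      intro q hq
      rcases List.mem_cons.mp (h1 q hq) with rfl | h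
      · exact absurd hc hq
      · exact h
    · left
      have e : n = Finsupp.single c 1 + (n - Finsupp.single c 1) := by
        ext q
        by_cases hq : c = q
        · subst hq; simp; omega
        · simp [hq]
      have e2 : r + n = absOp c r + (n - Finsupp.single c 1) := by
        rw [absOp, add_assoc, ← e]
      rw [e2]
      apply genL_complete (c :: cs) s
      · intro q hq
        apply h1
        intro h0
        apply hq
        simp [h0]
      · have := congrArg Finsupp.degree e
        rw [map_add, h2] at this
        simp at this
        omega
  termination_by cs s _ _ => cs.length + s

theorem rowsL_complete (bs : List (List Idx × ℕ)) : ∀ (r : Idx →₀ ℕ) (ns : List (Idx →₀ ℕ)),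
    List.Forall₂ (fun b n => (∀ q, n q ≠ 0 → q ∈ b.1) ∧ n.degree = b.2) bs ns →
    r + ns.sum ∈ rowsL absOp bs r := by
  induction bs with
  | nil => intro r ns h; cases h; simp [rowsL]
  | cons b bs ih =>
    intro r ns h
    cases h with
    | cons h1 h2 =>
      rw [rowsL, List.mem_flatMap, List.sum_cons, ← add_assoc]
      exact ⟨_, genL_complete b.1 b.2 r _ h1.1 h1.2, ih _ _ h2⟩

/-! ### Linear independence of the class polynomials -/

def wt (q : Idx) : ℕ :=
  (![13, 19, 4, 12] : Fin 4 → ℕ) q.1 + (![0, 12, 3, 4] : Fin 4 → ℕ) q.2.1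
    + (![1, 20, 10, 9] : Fin 4 → ℕ) q.2.2

def key1 (q : Idx) : ℕ := 8 ^ (q.1 : ℕ) + 8 ^ (4 + (q.2.1 : ℕ)) + 8 ^ (8 + (q.2.2 : ℕ))

def keyN (n : Idx →₀ ℕ) : ℕ := n.sum fun q e => e * key1 q

def polyN (n : Idx →₀ ℕ) : Polynomial ℤ := n.prod fun q e => (1 + Polynomial.X ^ wt q) ^ e

theorem keyN_absOp (c : Idx) (n : Idx →₀ ℕ) : keyN (absOp c n) = keyN n + key1 c := by
  rw [keyN, absOp, Finsupp.sum_add_index' (by simp) (by intros; ring)]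
  simp [keyN]

theorem polyN_absOp (c : Idx) (n : Idx →₀ ℕ) :
    polyN (absOp c n) = polyN n * (1 + Polynomial.X ^ wt c) := by
  rw [polyN, absOp, Finsupp.prod_add_index' (by simp) (by intros; ring)]
  simp [polyN]

def relCell (q : Idx) (c : Row) : Prop := c.k = key1 q ∧ c.p = wt q

def relRow (n : Idx →₀ ℕ) (r : Row) : Prop :=
  r.k = keyN n ∧ ∀ i, Odd ((polyN n).coeff i) ↔ r.p.testBit i = true

theorem relRow_op (c : Idx) (c' : Row) (r : Idx →₀ ℕ) (r' : Row) (hc : relCell c c')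
    (hr : relRow r r') : relRow (absOp c r) (rowOp c' r') := by
  refine ⟨?_, ?_⟩
  · rw [keyN_absOp, ← hc.1, ← hr.1]; rfl
  · intro i
    rw [polyN_absOp, mul_add, mul_one, Polynomial.coeff_add, Polynomial.coeff_mul_X_pow', ← hc.2]
    change _ ↔ (r'.p ^^^ (r'.p <<< c'.p)).testBit i = true
    rw [Nat.testBit_xor, Nat.testBit_shiftLeft]
    by_cases h : c'.p ≤ i
    · rw [if_pos h, Int.odd_add, hr.2, ← Int.not_odd_iff_even, hr.2]
      simp only [ge_iff_le, h, decide_true, Bool.true_and]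
      cases r'.p.testBit i <;> cases r'.p.testBit (i - c'.p) <;> simp
    · rw [if_neg h, add_zero, hr.2]
      simp [h]

def ablock0 : List Idx := [(0,1,2), (0,1,3), (0,2,1), (0,2,3), (0,3,1), (0,3,2)]
def ablock1 : List Idx := [(1,0,2), (1,0,3), (1,2,0), (1,2,3), (1,3,0), (1,3,2)]
def ablock2 : List Idx := [(2,0,1), (2,0,3), (2,1,0), (2,1,3), (2,3,0), (2,3,1)]
def ablock3 : List Idx := [(3,0,1), (3,0,2), (3,1,0), (3,1,2), (3,2,0), (3,2,1)]

theorem block_rel : List.Forall₂ relCell ablock0 block0 ∧ List.Forall₂ relCell ablock1 block1 ∧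
    List.Forall₂ relCell ablock2 block2 ∧ List.Forall₂ relCell ablock3 block3 := by
  refine ⟨?_, ?_, ?_, ?_⟩ <;>
    · simp only [ablock0, ablock1, ablock2, ablock3, block0, block1, block2, block3,
        List.forall₂_cons, List.Forall₂.nil, and_true, relCell]
      decide

def Distinct3 (q : Idx) : Prop := q.1 ≠ q.2.1 ∧ q.2.1 ≠ q.2.2 ∧ q.1 ≠ q.2.2

instance : DecidablePred Distinct3 := fun q => by unfold Distinct3; infer_instance

def ablk (i : Fin 4) : List Idx := (![ablock0, ablock1, ablock2, ablock3] : Fin 4 → List Idx) i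

theorem mem_ablk : ∀ (i : Fin 4) (q : Idx), Distinct3 q → q.1 = i → q ∈ ablk i := by
  decide

def margA (n : Idx →₀ ℕ) (i : Fin 4) : ℕ := (n.filter (fun q => q.1 = i)).degree

def cblk (a : Fin 4 → ℕ) : List (List Row × ℕ) :=
  [(block0, a 0), (block1, a 1), (block2, a 2), (block3, a 3)]

def cablk (a : Fin 4 → ℕ) : List (List Idx × ℕ) :=
  [(ablk 0, a 0), (ablk 1, a 1), (ablk 2, a 2), (ablk 3, a 3)]

theorem mem_rows (n : Idx →₀ ℕ) (hn : ∀ q, n q ≠ 0 → Distinct3 q) :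
    n ∈ rowsL absOp (cablk (margA n)) 0 := by
  have h := rowsL_complete (cablk (margA n)) 0
    [n.filter (fun q => q.1 = 0), n.filter (fun q => q.1 = 1),
      n.filter (fun q => q.1 = 2), n.filter (fun q => q.1 = 3)] (by
    simp only [cablk, List.forall₂_cons, List.Forall₂.nil, and_true]
    have key : ∀ i : Fin 4, (∀ q, (n.filter (fun q => q.1 = i)) q ≠ 0 → q ∈ ablk i) := by
      intro i q hq
      rw [Finsupp.filter_apply] at hq
      split_ifs at hq with h
      · exact mem_ablk i q (hn q hq) h
      · exact absurd rfl hq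
    exact ⟨⟨key 0, rfl⟩, ⟨key 1, rfl⟩, ⟨key 2, rfl⟩, ⟨key 3, rfl⟩⟩)
  convert h using 1
  ext q
  simp only [List.sum_cons, List.sum_nil, add_zero, zero_add, Finsupp.add_apply,
    Finsupp.filter_apply]
  obtain ⟨i, j, k⟩ := q
  fin_cases i <;> simp

theorem forall2_sublist {α β : Type} {R : α → β → Prop} {l' l : List α} (h : l'.Sublist l) :
    ∀ m, List.Forall₂ R l m → ∃ m', m'.Sublist m ∧ List.Forall₂ R l' m' := by
  induction h with
  | slnil => intro m hm; exact ⟨[], by simp, List.Forall₂.nil⟩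
  | cons a _ ih =>
    intro m hm
    cases hm with
    | cons h1 h2 =>
      obtain ⟨m', hm', hr⟩ := ih _ h2
      exact ⟨m', hm'.cons _, hr⟩
  | cons_cons a _ ih =>
    intro m hm
    cases hm with
    | cons h1 h2 =>
      obtain ⟨m', hm', hr⟩ := ih _ h2
      exact ⟨_, hm'.cons_cons _, List.Forall₂.cons h1 hr⟩

theorem forall2_parity {l : List (Idx →₀ ℕ)} {m : List Row} (h : List.Forall₂ relRow l m) (i : ℕ) :
    Odd ((l.map fun n => (polyN n).coeff i).sum) ↔ Odd (m.countP fun r => r.p.testBit i) := by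
  induction h with
  | nil => simp
  | cons h1 h2 ih =>
    rw [List.map_cons, List.sum_cons, List.countP_cons, add_comm, Int.odd_add, ih,
      ← Int.not_odd_iff_even, h1.2]
    split_ifs with h
    · simp [h, Nat.odd_add_one]
    · simp [h]

theorem class_odd (a : Fin 4 → ℕ) (hchk : checkRows (a 0) (a 1) (a 2) (a 3) = true) (K : ℕ)
    (T : Finset (Idx →₀ ℕ)) (hT : ∀ n ∈ T, (∀ q, n q ≠ 0 → Distinct3 q) ∧ margA n = a ∧ keyN n = K)
    (hT0 : T.Nonempty) : ∃ i, Odd (∑ n ∈ T, (polyN n).coeff i) := by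
  have hle : T.val ≤ ((rowsL absOp (cablk a) 0 : List (Idx →₀ ℕ)) : Multiset (Idx →₀ ℕ)) := by
    rw [Multiset.le_iff_subset T.nodup]
    intro n hn
    obtain ⟨h1, h2, -⟩ := hT n hn
    have := mem_rows n h1
    rw [h2] at this
    exact this
  rw [← Finset.coe_toList] at hle
  obtain ⟨l', hp, hs⟩ := Multiset.coe_le.mp hle
  have hrel : List.Forall₂ relRow (rowsL absOp (cablk a) 0) (rowsL rowOp (cblk a) ⟨0, 1⟩) := by
    apply rowsL_rel absOp rowOp relCell relRow relRow_op
    · simp only [cablk, cblk, List.forall₂_cons, List.Forall₂.nil, and_true]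
      exact block_rel
    · refine ⟨by simp [keyN], fun i => ?_⟩
      simp only [polyN, Finsupp.prod_zero_index, Polynomial.coeff_one]
      rw [Nat.testBit_one_eq_true_iff_self_eq_zero]
      split_ifs with h <;> simp [h]
  obtain ⟨m', hm', hr⟩ := forall2_sublist hs _ hrel
  have hsound := radix_sound _ _ hchk K
  rw [rowsOf_eq] at hsound
  have hmem : ∀ n ∈ l', n ∈ T := fun n hn => by simpa using hp.mem_iff.mp hn
  have hk : ∀ r ∈ m', r.k = K := by
    have : ∀ (l : List (Idx →₀ ℕ)) (m : List Row), List.Forall₂ relRow l m → (∀ n ∈ l, n ∈ T) →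
        ∀ r ∈ m, r.k = K := by
      intro l m h
      induction h with
      | nil => simp
      | cons h1 h2 ih =>
        intro h r hr
        rcases List.mem_cons.mp hr with rfl | hr
        · rw [h1.1]; exact (hT _ (h _ (by simp))).2.2
        · exact ih (fun n hn => h n (by simp [hn])) r hr
    exact this _ _ hr hmem
  obtain ⟨i, hi⟩ := hsound (m' : Multiset Row) (by
    rw [Multiset.le_filter]
    exact ⟨Multiset.coe_le.mpr hm'.subperm, by simpa using hk⟩) (by
    intro h0
    have h1 : m' = [] := by simpa using h0
    subst h1
    cases hr
    obtain ⟨n, hn⟩ := hT0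
    have := hp.symm.eq_nil
    rw [Finset.toList_eq_nil] at this
    simp [this] at hn)
  refine ⟨i, ?_⟩
  rw [← Finset.sum_map_toList, ← (hp.map _).sum_eq, forall2_parity hr]
  simpa using hi

theorem int_descent {ι : Type} (S : Finset ι) (M : ι → ℕ → ℤ)
    (hodd : ∀ T ⊆ S, T.Nonempty → ∃ i, Odd (∑ n ∈ T, M n i)) (k : ℕ) :
    ∀ c : ι → ℤ, (∀ i, ∑ n ∈ S, c n * M n i = 0) → ∀ n ∈ S, (2 : ℤ) ^ k ∣ c n := by
  classical
  induction k with
  | zero => intro c _ n _; simp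
  | succ k ih =>
    intro c hc
    have heven : ∀ n ∈ S, Even (c n) := by
      by_contra hcon
      push Not at hcon
      obtain ⟨n0, hn0, h0⟩ := hcon
      obtain ⟨i, hi⟩ := hodd (S.filter fun n => Odd (c n)) (Finset.filter_subset _ _)
        ⟨n0, by simp [hn0, Int.not_even_iff_odd.mp h0]⟩
      have h1 := hc i
      rw [← Finset.sum_filter_add_sum_filter_not S (fun n => Odd (c n))] at h1
      have h2 : Even (∑ n ∈ S.filter (fun n => ¬ Odd (c n)), c n * M n i) := by
        apply Finset.even_sum
        intro n hn
        exact (Int.not_odd_iff_even.mp (Finset.mem_filter.mp hn).2).mul_right _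
      have h3 : Even (∑ n ∈ S.filter (fun n => Odd (c n)), (c n * M n i - M n i)) := by
        apply Finset.even_sum
        intro n hn
        have h := (Finset.mem_filter.mp hn).2
        rw [show c n * M n i - M n i = (c n - 1) * M n i by ring]
        exact (h.sub_odd odd_one).mul_right _
      rw [Finset.sum_sub_distrib] at h3
      rw [Int.odd_iff] at hi
      rw [Int.even_iff] at h2 h3
      omega
    choose! c' hc' using heven
    have h := ih c' (by
      intro i
      have h1 := hc i
      have h2 : ∑ n ∈ S, c n * M n i = 2 * ∑ n ∈ S, c' n * M n i := by
        rw [Finset.mul_sum]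
        apply Finset.sum_congr rfl
        intro n hn
        rw [hc' n hn]; ring
      omega)
    intro n hn
    rw [hc' n hn, pow_succ]
    obtain ⟨t, ht⟩ := h n hn
    exact ⟨t, by rw [ht]; ring⟩

theorem int_indep {ι : Type} (S : Finset ι) (M : ι → ℕ → ℤ)
    (hodd : ∀ T ⊆ S, T.Nonempty → ∃ i, Odd (∑ n ∈ T, M n i))
    (c : ι → ℤ) (hc : ∀ i, ∑ n ∈ S, c n * M n i = 0) : ∀ n ∈ S, c n = 0 := by
  intro n hn
  by_contra h
  have h1 := int_descent S M hodd (c n).natAbs c hc n hn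
  have h2 := Int.natAbs_dvd_natAbs.mpr h1
  have h3 := Nat.le_of_dvd (Int.natAbs_pos.mpr h) h2
  rw [Int.natAbs_pow] at h3
  exact absurd h3 (not_le.mpr (Nat.lt_two_pow_self))

theorem rat_indep {ι : Type} (S : Finset ι) (M : ι → ℕ → ℤ)
    (hodd : ∀ T ⊆ S, T.Nonempty → ∃ i, Odd (∑ n ∈ T, M n i))
    (c : ι → ℚ) (hc : ∀ i, ∑ n ∈ S, c n * M n i = 0) : ∀ n ∈ S, c n = 0 := by
  obtain ⟨b, hb⟩ := IsLocalization.exist_integer_multiples_of_finset (nonZeroDivisors ℤ)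
    (S.image c)
  have hb' : ∀ n ∈ S, ∃ z : ℤ, (z : ℚ) = (b : ℤ) * c n := by
    intro n hn
    obtain ⟨z, hz⟩ := hb (c n) (Finset.mem_image_of_mem c hn)
    refine ⟨z, ?_⟩
    simpa using hz
  choose! z hz using hb'
  have hb0 : ((b : ℤ) : ℚ) ≠ 0 := by
    exact_mod_cast nonZeroDivisors.coe_ne_zero b
  have h := int_indep S M hodd z (by
    intro i
    have h2 : ((∑ n ∈ S, z n * M n i : ℤ) : ℚ) = 0 := by
      push_cast
      rw [← mul_zero ((b : ℤ) : ℚ), ← hc i, Finset.mul_sum]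
      apply Finset.sum_congr rfl
      intro n hn
      rw [hz n hn]; ring
    exact_mod_cast h2)
  intro n hn
  have := hz n hn
  rw [h n hn] at this
  simpa [hb0] using this.symm

theorem cpx_indep {ι : Type} (S : Finset ι) (M : ι → ℕ → ℤ)
    (hodd : ∀ T ⊆ S, T.Nonempty → ∃ i, Odd (∑ n ∈ T, M n i))
    (c : ι → ℂ) (hc : ∀ i, ∑ n ∈ S, c n * M n i = 0) : ∀ n ∈ S, c n = 0 := by
  intro n hn
  rw [← Module.forall_dual_apply_eq_zero_iff ℚ]
  intro φ
  refine rat_indep S M hodd (fun n => φ (c n)) ?_ n hn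
  intro i
  have := congrArg φ (hc i)
  rw [map_sum, map_zero] at this
  rw [← this]
  apply Finset.sum_congr rfl
  intro n hn
  have e : c n * (M n i : ℂ) = (M n i : ℚ) • c n := by
    rw [Algebra.smul_def]; simp [mul_comm]
  rw [e, map_smul, smul_eq_mul, mul_comm]

/-! ### Polynomials of degree at most six in the off-diagonal cells -/

def tens (a b c : Fin 4 → ℂ) : Idx → ℂ := fun x => a x.1 * b x.2.1 * c x.2.2

theorem degree_eq_sum_idx (n : Idx →₀ ℕ) : n.degree = ∑ q, n q :=
  Finsupp.degree_eq_sum n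

theorem margA_eq (n : Idx →₀ ℕ) (i : Fin 4) :
    margA n i = ∑ q : Idx, if q.1 = i then n q else 0 := by
  rw [margA, degree_eq_sum_idx]
  apply Finset.sum_congr rfl
  intro q _
  rw [Finsupp.filter_apply]

theorem margA_sum (n : Idx →₀ ℕ) : margA n 0 + margA n 1 + margA n 2 + margA n 3 = n.degree := by
  rw [margA_eq, margA_eq, margA_eq, margA_eq, degree_eq_sum_idx, ← Finset.sum_add_distrib,
    ← Finset.sum_add_distrib, ← Finset.sum_add_distrib]
  apply Finset.sum_congr rfl
  rintro ⟨i, j, k⟩ _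
  fin_cases i <;> simp

theorem keyN_decomp (n : Idx →₀ ℕ) : ∃ R, keyN n =
    margA n 0 + 8 * margA n 1 + 64 * margA n 2 + 512 * margA n 3 + 4096 * R := by
  refine ⟨∑ q : Idx, n q * (8 ^ (q.2.1 : ℕ) + 8 ^ (4 + (q.2.2 : ℕ))), ?_⟩
  rw [margA_eq, margA_eq, margA_eq, margA_eq, keyN, Finsupp.sum_fintype _ _ (by simp)]
  simp only [Finset.mul_sum, ← Finset.sum_add_distrib]
  apply Finset.sum_congr rfl
  rintro ⟨i, j, k⟩ _
  fin_cases i <;> simp [key1] <;> ring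

theorem margA_of_key (n n' : Idx →₀ ℕ) (h : n.degree = 6) (h' : n'.degree = 6)
    (hk : keyN n = keyN n') : margA n = margA n' := by
  obtain ⟨R, hR⟩ := keyN_decomp n
  obtain ⟨R', hR'⟩ := keyN_decomp n'
  have h1 := margA_sum n
  have h2 := margA_sum n'
  have e0 : margA n 0 = margA n' 0 := by omega
  have e1 : margA n 1 = margA n' 1 := by omega
  have e2 : margA n 2 = margA n' 2 := by omega
  have e3 : margA n 3 = margA n' 3 := by omega
  funext i
  fin_cases i
  exacts [e0, e1, e2, e3]

theorem check_antitone (a : Fin 4 → ℕ) (ha : Antitone a) (h : a 0 + a 1 + a 2 + a 3 = 6) :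
    checkRows (a 0) (a 1) (a 2) (a 3) = true := by
  have h1 : a 1 ≤ a 0 := ha (by decide)
  have h2 : a 2 ≤ a 1 := ha (by decide)
  have h3 : a 3 ≤ a 2 := ha (by decide)
  have hall := checkRows_all
  generalize checkRows = f at hall ⊢
  obtain ⟨c1, c2, c3, c4, c5, c6, c7, c8, c9⟩ := hall
  generalize a 0 = x at *
  generalize a 1 = y at *
  generalize a 2 = z at *
  generalize a 3 = w at *
  have hx : x ≤ 6 := by omega
  have hy : y ≤ 3 := by omega
  have hz : z ≤ 2 := by omega
  have hw : w ≤ 1 := by omega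
  interval_cases w <;> interval_cases z <;> interval_cases y <;> first
    | (exfalso; omega)
    | (obtain rfl : x = 6 := by omega
       assumption)
    | (obtain rfl : x = 5 := by omega
       assumption)
    | (obtain rfl : x = 4 := by omega
       assumption)
    | (obtain rfl : x = 3 := by omega
       assumption)
    | (obtain rfl : x = 2 := by omega
       assumption)

theorem eval_curve (H : MvPolynomial Idx ℂ)
    (hv : ∀ a b c a' b' c' : Fin 4 → ℂ,
      MvPolynomial.eval (fun x => tens a b c x + tens a' b' c' x) H = 0) (s t : ℂ) :
    ∑ n ∈ H.support, H.coeff n * (s ^ keyN n * ((polyN n).map (Int.castRingHom ℂ)).eval t) = 0 := by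
  have h := hv (fun i => s ^ (8 ^ (i : ℕ))) (fun j => s ^ (8 ^ (4 + (j : ℕ))))
    (fun k => s ^ (8 ^ (8 + (k : ℕ))))
    (fun i => s ^ (8 ^ (i : ℕ)) * t ^ ((![13, 19, 4, 12] : Fin 4 → ℕ) i))
    (fun j => s ^ (8 ^ (4 + (j : ℕ))) * t ^ ((![0, 12, 3, 4] : Fin 4 → ℕ) j))
    (fun k => s ^ (8 ^ (8 + (k : ℕ))) * t ^ ((![1, 20, 10, 9] : Fin 4 → ℕ) k))
  have e : (fun x : Idx => tens (fun i => s ^ (8 ^ (i : ℕ))) (fun j => s ^ (8 ^ (4 + (j : ℕ))))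
    (fun k => s ^ (8 ^ (8 + (k : ℕ)))) x + tens
    (fun i => s ^ (8 ^ (i : ℕ)) * t ^ ((![13, 19, 4, 12] : Fin 4 → ℕ) i))
    (fun j => s ^ (8 ^ (4 + (j : ℕ))) * t ^ ((![0, 12, 3, 4] : Fin 4 → ℕ) j))
    (fun k => s ^ (8 ^ (8 + (k : ℕ))) * t ^ ((![1, 20, 10, 9] : Fin 4 → ℕ) k)) x)
    = fun x => s ^ key1 x * (1 + t ^ wt x) := by
    funext x
    simp only [tens, key1, wt, pow_add]
    ring
  rw [e, MvPolynomial.eval_eq] at h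
  rw [← h]
  apply Finset.sum_congr rfl
  intro n _
  congr 1
  simp only [keyN, polyN, Finsupp.sum, Finsupp.prod, Polynomial.map_prod, Polynomial.eval_prod,
    mul_pow, Finset.prod_mul_distrib]
  congr 1
  · rw [← Finset.prod_pow_eq_pow_sum]
    apply Finset.prod_congr rfl
    intro q _
    rw [← pow_mul, mul_comm]
  · apply Finset.prod_congr rfl
    intro q _
    simp

theorem class_eq (H : MvPolynomial Idx ℂ)
    (hv : ∀ a b c a' b' c' : Fin 4 → ℂ,
      MvPolynomial.eval (fun x => tens a b c x + tens a' b' c' x) H = 0) (K i : ℕ) :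
    ∑ n ∈ H.support.filter (fun n => keyN n = K), H.coeff n * ((polyN n).coeff i : ℂ) = 0 := by
  have h1 : ∀ t : ℂ, ∑ n ∈ H.support.filter (fun n => keyN n = K),
      H.coeff n * ((polyN n).map (Int.castRingHom ℂ)).eval t = 0 := by
    intro t
    have h2 : ∑ n ∈ H.support, Polynomial.monomial (keyN n)
        (H.coeff n * ((polyN n).map (Int.castRingHom ℂ)).eval t) = 0 := by
      apply Polynomial.funext
      intro s
      rw [Polynomial.eval_finsetSum, Polynomial.eval_zero, ← eval_curve H hv s t]
      apply Finset.sum_congr rfl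
      intro n _
      rw [Polynomial.eval_monomial]
      ring
    have h3 := congrArg (fun p => Polynomial.coeff p K) h2
    simp only [Polynomial.finsetSum_coeff, Polynomial.coeff_monomial, Polynomial.coeff_zero] at h3
    rw [Finset.sum_filter]
    exact h3
  have h2 : ∑ n ∈ H.support.filter (fun n => keyN n = K),
      Polynomial.C (H.coeff n) * ((polyN n).map (Int.castRingHom ℂ)) = 0 := by
    apply Polynomial.funext
    intro t
    rw [Polynomial.eval_finsetSum, Polynomial.eval_zero, ← h1 t]
    apply Finset.sum_congr rfl
    intro n _
    simp
  have h3 := congrArg (fun p => Polynomial.coeff p i) h2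
  simpa only [Polynomial.finsetSum_coeff, Polynomial.coeff_C_mul, Polynomial.coeff_map,
    Polynomial.coeff_zero, eq_intCast] using h3

theorem N2_sorted (H : MvPolynomial Idx ℂ) (hH : H.IsHomogeneous 6)
    (hs : ∀ n, H.coeff n ≠ 0 → ∀ q, n q ≠ 0 → Distinct3 q)
    (hv : ∀ a b c a' b' c' : Fin 4 → ℂ,
      MvPolynomial.eval (fun x => tens a b c x + tens a' b' c' x) H = 0)
    (n₀ : Idx →₀ ℕ) (hn : Antitone (margA n₀)) : H.coeff n₀ = 0 := by
  by_contra h0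
  have hdeg : ∀ n, H.coeff n ≠ 0 → n.degree = 6 := by
    intro n hn
    by_contra h
    exact hn (hH.coeff_eq_zero h)
  refine h0 (cpx_indep (H.support.filter (fun n => keyN n = keyN n₀))
    (fun n i => (polyN n).coeff i) ?_ (fun n => H.coeff n) (class_eq H hv (keyN n₀)) n₀ ?_)
  · intro T hT hT0
    refine class_odd (margA n₀) (check_antitone _ hn ?_) (keyN n₀) T ?_ hT0
    · rw [margA_sum, hdeg _ h0]
    · intro n hn
      have h1 := Finset.mem_filter.mp (hT hn)
      have h2 := MvPolynomial.mem_support_iff.mp h1.1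
      exact ⟨hs n h2, margA_of_key _ _ (hdeg _ h2) (hdeg _ h0) h1.2, h1.2⟩
  · simp [h0]

theorem N2_six (H : MvPolynomial Idx ℂ) (hH : H.IsHomogeneous 6)
    (hs : ∀ n, H.coeff n ≠ 0 → ∀ q, n q ≠ 0 → Distinct3 q)
    (hv : ∀ a b c a' b' c' : Fin 4 → ℂ,
      MvPolynomial.eval (fun x => tens a b c x + tens a' b' c' x) H = 0) : H = 0 := by
  ext n
  rw [MvPolynomial.coeff_zero]
  obtain ⟨σ, hσ⟩ : ∃ σ : Equiv.Perm (Fin 4), Antitone (margA n ∘ σ) := by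
    refine ⟨Tuple.sort (fun i => OrderDual.toDual (margA n i)), ?_⟩
    have := Tuple.monotone_sort (fun i => OrderDual.toDual (margA n i))
    intro i j hij
    exact this hij
  let e : Idx ≃ Idx := σ.symm.prodCongr (σ.symm.prodCongr σ.symm)
  rw [← MvPolynomial.coeff_rename_mapDomain e e.injective]
  apply N2_sorted (MvPolynomial.rename e H) hH.rename_isHomogeneous
  · intro n' hn' q hq
    obtain ⟨u, hu, hu0⟩ := MvPolynomial.coeff_rename_ne_zero _ _ _ hn'
    rw [← hu, ← Finsupp.equivMapDomain_eq_mapDomain, Finsupp.equivMapDomain_apply] at hq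
    have := hs u hu0 _ hq
    obtain ⟨i, j, k⟩ := q
    simpa [Distinct3, e] using this
  · intro a b c a' b' c'
    rw [MvPolynomial.eval_rename]
    exact hv (a ∘ σ.symm) (b ∘ σ.symm) (c ∘ σ.symm) (a' ∘ σ.symm) (b' ∘ σ.symm) (c' ∘ σ.symm)
  · have : margA (Finsupp.mapDomain e n) = margA n ∘ σ := by
      funext i
      rw [Function.comp, margA_eq, margA_eq, ← e.sum_comp]
      apply Finset.sum_congr rfl
      intro q _
      rw [← Finsupp.equivMapDomain_eq_mapDomain, Finsupp.equivMapDomain_apply,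
        e.symm_apply_apply]
      simp [e, Equiv.symm_apply_eq]
    rw [this]
    exact hσ

theorem N2 (m : ℕ) (hm : m ≤ 6) (H : MvPolynomial Idx ℂ) (hH : H.IsHomogeneous m)
    (hs : ∀ n, H.coeff n ≠ 0 → ∀ q, n q ≠ 0 → Distinct3 q)
    (hv : ∀ a b c a' b' c' : Fin 4 → ℂ,
      MvPolynomial.eval (fun x => tens a b c x + tens a' b' c' x) H = 0) : H = 0 := by
  have h : H * MvPolynomial.X ((0, 1, 2) : Idx) ^ (6 - m) = 0 := by
    apply N2_six
    · have := hH.mul (MvPolynomial.isHomogeneous_X_pow (R := ℂ) ((0, 1, 2) : Idx) (6 - m))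
      rwa [Nat.add_sub_cancel' hm] at this
    · intro n hn q hq
      have h1 := MvPolynomial.support_mul _ _ (MvPolynomial.mem_support_iff.mpr hn)
      obtain ⟨n1, hn1, n2, hn2, rfl⟩ := Finset.mem_add.mp h1
      by_cases h : n1 q = 0
      · have h2 : n2 q ≠ 0 := by
          intro h2; apply hq; simp [h, h2]
        rw [MvPolynomial.support_X_pow, Finset.mem_singleton] at hn2
        rw [hn2, Finsupp.single_apply] at h2
        have : (0, 1, 2) = q := by
          by_contra h3; simp [h3] at h2
        rw [← this]; decide
      · exact hs n1 (MvPolynomial.mem_support_iff.mp hn1) q h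
    · intro a b c a' b' c'
      rw [map_mul, hv, zero_mul]
  rcases mul_eq_zero.mp h with h | h
  · exact h
  · exact absurd h (pow_ne_zero _ (MvPolynomial.X_ne_zero _))

/-! ### Order of vanishing along the fourth secant variety -/

def pt (a b c : Fin 4 → Fin 4 → ℂ) : Idx → ℂ := fun x => ∑ r, tens (a r) (b r) (c r) x

/-- The expansion of `f` at `P` in the direction `Y`. -/
def Qg {R : Type} [CommRing R] [Algebra ℂ R] (f : MvPolynomial Idx ℂ) (P Y : Idx → R) :
    Polynomial R :=
  MvPolynomial.aeval (fun x => Polynomial.C (P x) + Polynomial.X * Polynomial.C (Y x)) f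

theorem Qg_map {R S : Type} [CommRing R] [Algebra ℂ R] [CommRing S] [Algebra ℂ S]
    (φ : R →ₐ[ℂ] S) (f : MvPolynomial Idx ℂ) (P Y : Idx → R) (j : ℕ) :
    φ ((Qg f P Y).coeff j) = (Qg f (fun x => φ (P x)) (fun x => φ (Y x))).coeff j := by
  have h : Polynomial.mapAlgHom φ (Qg f P Y) = Qg f (fun x => φ (P x)) (fun x => φ (Y x)) := by
    rw [Qg, Qg, ← AlgHom.comp_apply, MvPolynomial.comp_aeval]
    congr 2
    funext x
    simp
  rw [← h]
  simp

theorem Qg_eval {R : Type} [CommRing R] [Algebra ℂ R] (f : MvPolynomial Idx ℂ) (P Y : Idx → R)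
    (e : R) : (Qg f P Y).eval e = MvPolynomial.aeval (fun x => P x + e * Y x) f := by
  have h : ∀ p : Polynomial R, p.eval e = ((Polynomial.aeval e).restrictScalars ℂ) p := by
    intro p; simp [Polynomial.aeval_def, Polynomial.eval₂_eq_eval_map]
  rw [h, Qg, ← AlgHom.comp_apply, MvPolynomial.comp_aeval]
  congr 2
  funext x
  simp
  exact mul_comm _ _

theorem aevE {σ : Type} (z : σ → ℂ) (g : MvPolynomial σ ℂ) :
    MvPolynomial.aeval z g = MvPolynomial.eval z g := by
  rw [← MvPolynomial.coe_aeval_eq_eval]; rfl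

theorem aevP (z : ℂ) (g : Polynomial ℂ) : Polynomial.aeval z g = Polynomial.eval z g := by
  rw [← Polynomial.coe_aeval_eq_eval]

def OrdGe (f : MvPolynomial Idx ℂ) (m : ℕ) : Prop :=
  ∀ a b c (y : Idx → ℂ), ∀ j < m, (Qg f (pt a b c) y).coeff j = 0

theorem bivar (m : ℕ) (G : Polynomial (Polynomial ℂ))
    (h : ∀ j < m, ∀ δ : ℂ, (G.coeff j).eval δ = 0) :
    (G.eval Polynomial.X).coeff m = (G.coeff m).eval 0 := by
  have h1 : ∀ j < m, G.coeff j = 0 := by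
    intro j hj
    apply Polynomial.funext
    intro δ
    rw [h j hj δ, Polynomial.eval_zero]
  obtain ⟨G', rfl⟩ := Polynomial.X_pow_dvd_iff.mpr h1
  rw [Polynomial.eval_mul, Polynomial.eval_pow, Polynomial.eval_X, mul_comm,
    mul_comm (Polynomial.X ^ m) G']
  have e1 := Polynomial.coeff_mul_X_pow (Polynomial.eval Polynomial.X G') m 0
  have e2 := Polynomial.coeff_mul_X_pow G' m 0
  rw [zero_add] at e1 e2
  rw [e1, e2, Polynomial.coeff_zero_eq_eval_zero]
  have e3 : ∀ p : Polynomial (Polynomial ℂ),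
      (p.eval Polynomial.X).eval 0 = (p.coeff 0).eval 0 := by
    intro p
    induction p using Polynomial.induction_on' with
    | add p q hp hq => simp [hp, hq]
    | monomial n a =>
      rw [Polynomial.eval_monomial, Polynomial.coeff_monomial]
      rcases n with _ | n
      · simp
      · simp
  exact e3 G'

theorem inv_pencil (f : MvPolynomial Idx ℂ) (m : ℕ) (hf : OrdGe f m) (p w y : Idx → ℂ)
    (hw : ∀ δ : ℂ, ∃ a b c, pt a b c = fun x => p x + δ * w x) :
    (Qg f p (fun x => y x + w x)).coeff m = (Qg f p y).coeff m := by
  obtain ⟨G, hGd⟩ : ∃ G : Polynomial (Polynomial ℂ), G = Qg f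
    (fun x => Polynomial.C (p x) + Polynomial.X * Polynomial.C (w x))
    (fun x => Polynomial.C (y x)) := ⟨_, rfl⟩
  have hG : ∀ j (δ : ℂ), (G.coeff j).eval δ = (Qg f (fun x => p x + δ * w x) y).coeff j := by
    intro j δ
    rw [← aevP, hGd, Qg_map]
    have e1 : (fun x => Polynomial.aeval δ (Polynomial.C (p x) + Polynomial.X * Polynomial.C (w x)))
        = fun x => p x + δ * w x := by
      funext x; rw [aevP]; simp; exact mul_comm _ _
    have e2 : (fun x => Polynomial.aeval δ (Polynomial.C (y x))) = y := by
      funext x; rw [aevP]; simp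
    rw [e1, e2]
  have h := bivar m G (by
    intro j hj δ
    obtain ⟨a, b, c, habc⟩ := hw δ
    rw [hG, ← habc]
    exact hf a b c y j hj)
  rw [hG] at h
  have e : G.eval Polynomial.X = Qg f p (fun x => y x + w x) := by
    rw [hGd, Qg_eval, Qg]
    congr 2
    funext x
    rw [map_add]
    ring
  rw [e] at h
  rw [h]
  have e3 : (fun x => p x + 0 * w x) = p := by
    funext x; ring
  rw [e3]

theorem coeff_kill (q : Idx) (H : MvPolynomial Idx ℂ) : ∀ n : Idx →₀ ℕ, n q ≠ 0 →
    (MvPolynomial.aeval (fun x => if x = q then (0 : MvPolynomial Idx ℂ) else MvPolynomial.X x)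
      H).coeff n = 0 := by
  classical
  have hmul : ∀ A B : MvPolynomial Idx ℂ, (∀ n : Idx →₀ ℕ, n q ≠ 0 → A.coeff n = 0) →
      (∀ n : Idx →₀ ℕ, n q ≠ 0 → B.coeff n = 0) → ∀ n : Idx →₀ ℕ, n q ≠ 0 → (A * B).coeff n = 0 := by
    intro A B hA hB n hn
    rw [MvPolynomial.coeff_mul]
    apply Finset.sum_eq_zero
    rintro ⟨n1, n2⟩ h
    rw [Finset.HasAntidiagonal.mem_antidiagonal] at h
    by_cases h1 : n1 q = 0
    · have h2 : n2 q ≠ 0 := by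
        intro h2; apply hn; rw [← h]; simp [h1, h2]
      rw [hB n2 h2, mul_zero]
    · rw [hA n1 h1, zero_mul]
  induction H using MvPolynomial.induction_on with
  | C a =>
    intro n hn
    rw [MvPolynomial.algHom_C, MvPolynomial.algebraMap_eq, MvPolynomial.coeff_C, if_neg]
    rintro rfl
    simp at hn
  | add p r hp hr =>
    intro n hn
    rw [map_add, MvPolynomial.coeff_add, hp n hn, hr n hn, add_zero]
  | mul_X p i hp =>
    rw [map_mul]
    apply hmul _ _ hp
    intro n hn
    rw [MvPolynomial.aeval_X]
    split_ifs with h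
    · simp
    · rw [MvPolynomial.coeff_X, if_neg]
      rintro rfl
      simp [h] at hn

theorem coeff_zero_of_update (q : Idx) (H : MvPolynomial Idx ℂ)
    (h : ∀ z : Idx → ℂ, MvPolynomial.eval (Function.update z q 0) H = MvPolynomial.eval z H)
    (n : Idx →₀ ℕ) (hn : n q ≠ 0) : H.coeff n = 0 := by
  have e : H = MvPolynomial.aeval
      (fun x => if x = q then (0 : MvPolynomial Idx ℂ) else MvPolynomial.X x) H := by
    apply MvPolynomial.funext
    intro z
    rw [← h z, ← MvPolynomial.coe_aeval_eq_eval, ← MvPolynomial.coe_aeval_eq_eval,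
      RingHom.coe_coe, RingHom.coe_coe, ← AlgHom.comp_apply, MvPolynomial.comp_aeval]
    congr 2
    funext x
    by_cases hx : x = q
    · subst hx; simp
    · simp [hx]
  rw [e]
  exact coeff_kill q H n hn

theorem Qg_homog (f : MvPolynomial Idx ℂ) (p : Idx → ℂ) (Y : Idx → MvPolynomial Idx ℂ)
    (hY : ∀ x, (Y x).IsHomogeneous 1) :
    ∀ j, ((Qg f (fun x => MvPolynomial.C (p x)) Y).coeff j).IsHomogeneous j := by
  have hmul : ∀ A B : Polynomial (MvPolynomial Idx ℂ), (∀ j, (A.coeff j).IsHomogeneous j) →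
      (∀ j, (B.coeff j).IsHomogeneous j) → ∀ j, ((A * B).coeff j).IsHomogeneous j := by
    intro A B hA hB j
    rw [Polynomial.coeff_mul]
    apply MvPolynomial.IsHomogeneous.sum
    rintro ⟨i, k⟩ h
    rw [Finset.HasAntidiagonal.mem_antidiagonal] at h
    rw [← h]
    exact (hA i).mul (hB k)
  have hC : ∀ (c : ℂ) (j : ℕ), ((Polynomial.C (MvPolynomial.C c) :
      Polynomial (MvPolynomial Idx ℂ)).coeff j).IsHomogeneous j := by
    intro c j
    rw [Polynomial.coeff_C]
    split_ifs with h
    · rw [h]; exact MvPolynomial.isHomogeneous_C _ _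
    · exact MvPolynomial.isHomogeneous_zero _ _ _
  unfold Qg
  induction f using MvPolynomial.induction_on with
  | C a =>
    intro j
    rw [MvPolynomial.algHom_C]
    exact hC a j
  | add A B hA hB =>
    intro j
    rw [map_add, Polynomial.coeff_add]
    exact (hA j).add (hB j)
  | mul_X A i hA =>
    rw [map_mul]
    apply hmul _ _ hA
    intro j
    rw [MvPolynomial.aeval_X, Polynomial.coeff_add]
    apply (hC _ j).add
    rcases j with _ | _ | j
    · simp only [Polynomial.mul_coeff_zero, Polynomial.coeff_X_zero, zero_mul]
      exact MvPolynomial.isHomogeneous_zero _ _ _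
    · simp only [zero_add, Polynomial.coeff_mul_C, Polynomial.coeff_X_one, one_mul]
      exact hY i
    · rw [Polynomial.coeff_mul_C, Polynomial.coeff_X, if_neg (by omega), zero_mul]
      exact MvPolynomial.isHomogeneous_zero _ _ _

def gT (a b c : Fin 4 → Fin 4 → ℂ) (z : Idx → ℂ) : Idx → ℂ := fun x =>
  ∑ q : Idx, z q * tens (a q.1) (b q.2.1) (c q.2.2) x

theorem gT_update (a b c : Fin 4 → Fin 4 → ℂ) (z : Idx → ℂ) (q : Idx) :
    gT a b c z = fun x => gT a b c (Function.update z q 0) x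
      + z q * tens (a q.1) (b q.2.1) (c q.2.2) x := by
  funext x
  simp only [gT]
  rw [← Finset.sum_erase_add _ _ (Finset.mem_univ q)]
  congr 1
  rw [← Finset.sum_erase_add (Finset.univ) (fun q' : Idx => Function.update z q 0 q' *
    tens (a q'.1) (b q'.2.1) (c q'.2.2) x) (Finset.mem_univ q)]
  simp only [Function.update_self, zero_mul, add_zero]
  apply Finset.sum_congr rfl
  intro q' hq'
  rw [Function.update_of_ne (Finset.ne_of_mem_erase hq')]

theorem gT_tens (a b c : Fin 4 → Fin 4 → ℂ) (u v w : Fin 4 → ℂ) :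
    gT a b c (tens u v w) = tens (fun i => ∑ r, u r * a r i) (fun i => ∑ r, v r * b r i)
      (fun i => ∑ r, w r * c r i) := by
  funext x
  simp only [gT, tens, Fintype.sum_prod_type]
  rw [mul_assoc, Finset.sum_mul]
  apply Finset.sum_congr rfl; intro i _
  rw [Finset.sum_mul, Finset.mul_sum]
  apply Finset.sum_congr rfl; intro j _
  rw [Finset.mul_sum, Finset.mul_sum]
  apply Finset.sum_congr rfl; intro k _
  ring

theorem gT_add (a b c : Fin 4 → Fin 4 → ℂ) (z z' : Idx → ℂ) (x : Idx) :
    gT a b c (fun q => z q + z' q) x = gT a b c z x + gT a b c z' x := by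
  simp only [gT, add_mul, Finset.sum_add_distrib]

/-- `f` vanishes on sums of `r` simple tensors. -/
def Vanish (f : MvPolynomial Idx ℂ) (r : ℕ) : Prop :=
  ∀ u v w : Fin r → Fin 4 → ℂ, MvPolynomial.eval (fun x => ∑ l, tens (u l) (v l) (w l) x) f = 0

theorem step_gT (f : MvPolynomial Idx ℂ) (hf : Vanish f 6) (m : ℕ) (hm : m ≤ 6) (ho : OrdGe f m)
    (a b c : Fin 4 → Fin 4 → ℂ) (z : Idx → ℂ) : (Qg f (pt a b c) (gT a b c z)).coeff m = 0 := by
  let Y : Idx → MvPolynomial Idx ℂ := fun x =>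
    ∑ q : Idx, MvPolynomial.X q * MvPolynomial.C (tens (a q.1) (b q.2.1) (c q.2.2) x)
  let H : MvPolynomial Idx ℂ := (Qg f (fun x => MvPolynomial.C (pt a b c x)) Y).coeff m
  have hev : ∀ z, MvPolynomial.eval z H = (Qg f (pt a b c) (gT a b c z)).coeff m := by
    intro z
    have h := Qg_map (MvPolynomial.aeval z) f (fun x => MvPolynomial.C (pt a b c x)) Y m
    have e1 : (fun x => MvPolynomial.aeval z (MvPolynomial.C (pt a b c x))) = pt a b c := by
      funext x; rw [aevE, MvPolynomial.eval_C]
    have e2 : (fun x => MvPolynomial.aeval z (Y x)) = gT a b c z := by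
      funext x
      simp only [Y, gT, map_sum, map_mul, MvPolynomial.aeval_X]
      apply Finset.sum_congr rfl; intro q _
      rw [aevE, MvPolynomial.eval_C]
    rw [e1, e2, aevE] at h
    exact h
  have hH : H.IsHomogeneous m := by
    apply Qg_homog
    intro x
    apply MvPolynomial.IsHomogeneous.sum
    intro q _
    exact (MvPolynomial.isHomogeneous_X _ q).mul (MvPolynomial.isHomogeneous_C _ _)
  have hH0 : H = 0 := by
    apply N2 m hm H hH
    · intro n hn q hq
      by_contra hd
      apply hn
      apply coeff_zero_of_update q H _ n hq
      intro z
      rw [hev, hev, gT_update a b c z q]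
      symm
      apply inv_pencil f m ho
      intro δ
      by_cases h1 : q.2.1 = q.2.2
      · refine ⟨fun r => if r = q.2.1 then fun i => a r i + δ * z q * a q.1 i else a r, b, c, ?_⟩
        funext x
        rw [pt, pt, ← Finset.sum_erase_add _ _ (Finset.mem_univ q.2.1),
          ← Finset.sum_erase_add Finset.univ (fun r => tens (a r) (b r) (c r) x)
            (Finset.mem_univ q.2.1), add_assoc]
        congr 1
        · apply Finset.sum_congr rfl
          intro r hr
          rw [if_neg (Finset.ne_of_mem_erase hr)]
        · simp only [tens, if_true, ← h1]; ring
      by_cases h2 : q.1 = q.2.2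
      · refine ⟨a, fun r => if r = q.1 then fun i => b r i + δ * z q * b q.2.1 i else b r, c, ?_⟩
        funext x
        rw [pt, pt, ← Finset.sum_erase_add _ _ (Finset.mem_univ q.1),
          ← Finset.sum_erase_add Finset.univ (fun r => tens (a r) (b r) (c r) x)
            (Finset.mem_univ q.1), add_assoc]
        congr 1
        · apply Finset.sum_congr rfl
          intro r hr
          rw [if_neg (Finset.ne_of_mem_erase hr)]
        · simp only [tens, if_true, ← h2]; ring
      have h3 : q.1 = q.2.1 := by
        by_contra h3
        exact hd ⟨h3, h1, h2⟩
      · refine ⟨a, b, fun r => if r = q.1 then fun i => c r i + δ * z q * c q.2.2 i else c r, ?_⟩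
        funext x
        rw [pt, pt, ← Finset.sum_erase_add _ _ (Finset.mem_univ q.1),
          ← Finset.sum_erase_add Finset.univ (fun r => tens (a r) (b r) (c r) x)
            (Finset.mem_univ q.1), add_assoc]
        congr 1
        · apply Finset.sum_congr rfl
          intro r hr
          rw [if_neg (Finset.ne_of_mem_erase hr)]
        · simp only [tens, if_true, ← h3]; ring
    · intro u v w u' v' w'
      rw [hev]
      have h0 : Qg f (pt a b c) (gT a b c fun x => tens u v w x + tens u' v' w' x) = 0 := by
        apply Polynomial.funext
        intro e
        rw [Qg_eval, Polynomial.eval_zero, aevE]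
        have h := hf ![a 0, a 1, a 2, a 3, fun i => e * ∑ r, u r * a r i,
            fun i => e * ∑ r, u' r * a r i]
          ![b 0, b 1, b 2, b 3, fun i => ∑ r, v r * b r i, fun i => ∑ r, v' r * b r i]
          ![c 0, c 1, c 2, c 3, fun i => ∑ r, w r * c r i, fun i => ∑ r, w' r * c r i]
        rw [← h]
        congr 2
        funext x
        rw [gT_add, gT_tens, gT_tens, pt, Fin.sum_univ_four, Fin.sum_univ_six]
        simp only [tens]
        simp
        ring
      rw [h0, Polynomial.coeff_zero]
  rw [← hev, hH0, map_zero]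

theorem gT_surj (a b c : Matrix (Fin 4) (Fin 4) ℂ) (ha : a.det ≠ 0) (hb : b.det ≠ 0)
    (hc : c.det ≠ 0) (y : Idx → ℂ) : ∃ z, gT a b c z = y := by
  have ia : a⁻¹ * a = 1 := Matrix.nonsing_inv_mul _ (isUnit_iff_ne_zero.mpr ha)
  have ib : b⁻¹ * b = 1 := Matrix.nonsing_inv_mul _ (isUnit_iff_ne_zero.mpr hb)
  have ic : c⁻¹ * c = 1 := Matrix.nonsing_inv_mul _ (isUnit_iff_ne_zero.mpr hc)
  refine ⟨fun q => ∑ x : Idx, y x * tens (a⁻¹ x.1) (b⁻¹ x.2.1) (c⁻¹ x.2.2) q, ?_⟩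
  funext x'
  have h1 : gT a b c (fun q => ∑ x : Idx, y x * tens (a⁻¹ x.1) (b⁻¹ x.2.1) (c⁻¹ x.2.2) q) x'
      = ∑ x : Idx, y x * gT a b c (tens (a⁻¹ x.1) (b⁻¹ x.2.1) (c⁻¹ x.2.2)) x' := by
    simp only [gT, Finset.sum_mul, Finset.mul_sum]
    rw [Finset.sum_comm]
    apply Finset.sum_congr rfl; intro i _
    apply Finset.sum_congr rfl; intro j _
    ring
  rw [h1]
  have key : ∀ (M : Matrix (Fin 4) (Fin 4) ℂ), M⁻¹ * M = 1 → ∀ i k,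
      ∑ r, M⁻¹ i r * M r k = if i = k then 1 else 0 := by
    intro M hM i k
    rw [← Matrix.mul_apply, hM, Matrix.one_apply]
  have hgt : ∀ x : Idx, gT a b c (tens (a⁻¹ x.1) (b⁻¹ x.2.1) (c⁻¹ x.2.2)) x' =
      (if x.1 = x'.1 then 1 else 0) * (if x.2.1 = x'.2.1 then 1 else 0) *
      (if x.2.2 = x'.2.2 then 1 else 0) := by
    intro x
    rw [← key a ia, ← key b ib, ← key c ic]
    exact congrFun (gT_tens a b c (a⁻¹ x.1) (b⁻¹ x.2.1) (c⁻¹ x.2.2)) x'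
  rw [Finset.sum_eq_single x']
  · rw [hgt]
    simp
  · intro x _ hx
    rw [hgt]
    by_cases h1 : x.1 = x'.1
    · by_cases h2 : x.2.1 = x'.2.1
      · by_cases h3 : x.2.2 = x'.2.2
        · exact absurd (Prod.ext h1 (Prod.ext h2 h3)) hx
        · rw [if_neg h3]; ring
      · rw [if_neg h2]; ring
    · rw [if_neg h1]; ring
  · intro h; exact absurd (Finset.mem_univ _) h

def shiftM (a : Matrix (Fin 4) (Fin 4) ℂ) (t : ℂ) : Matrix (Fin 4) (Fin 4) ℂ :=
  Matrix.scalar (Fin 4) t - (-a)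

theorem shiftM_zero (a : Matrix (Fin 4) (Fin 4) ℂ) : shiftM a 0 = a := by
  simp [shiftM]

theorem step_all (f : MvPolynomial Idx ℂ) (hf : Vanish f 6) (m : ℕ) (hm : m ≤ 6) (ho : OrdGe f m)
    (a b c : Matrix (Fin 4) (Fin 4) ℂ) (y : Idx → ℂ) : (Qg f (pt a b c) y).coeff m = 0 := by
  obtain ⟨L, hL⟩ : ∃ L : Matrix (Fin 4) (Fin 4) ℂ → Fin 4 → Fin 4 → Polynomial ℂ,
      ∀ M t r i, (L M r i).eval t = shiftM M t r i := by
    refine ⟨fun M r i => Polynomial.C (M r i) + Polynomial.X * Polynomial.C (if r = i then 1 else 0),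
      ?_⟩
    intro M t r i
    by_cases h : r = i
    · subst h; simp [shiftM, Matrix.sub_apply]; ring
    · simp [shiftM, Matrix.sub_apply, h]
  obtain ⟨T, hT⟩ : ∃ T : Polynomial ℂ, ∀ t, T.eval t =
      (Qg f (pt (shiftM a t) (shiftM b t) (shiftM c t)) y).coeff m := by
    refine ⟨(Qg f (fun x => ∑ r, L a r x.1 * L b r x.2.1 * L c r x.2.2)
      (fun x => Polynomial.C (y x))).coeff m, ?_⟩
    intro t
    rw [← aevP, Qg_map]
    congr 2
    · funext x
      rw [aevP, Polynomial.eval_finsetSum]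
      apply Finset.sum_congr rfl; intro r _
      rw [Polynomial.eval_mul, Polynomial.eval_mul, hL, hL, hL]
      rfl
    · funext x
      rw [aevP, Polynomial.eval_C]
  have h0 : T * ((-a).charpoly * (-b).charpoly * (-c).charpoly) = 0 := by
    apply Polynomial.funext
    intro t
    rw [Polynomial.eval_mul, Polynomial.eval_mul, Polynomial.eval_mul, Matrix.eval_charpoly,
      Matrix.eval_charpoly, Matrix.eval_charpoly, Polynomial.eval_zero]
    by_contra hne
    have hne' := mul_ne_zero_iff.mp hne
    have h2 := mul_ne_zero_iff.mp hne'.2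
    have h3 := mul_ne_zero_iff.mp h2.1
    obtain ⟨z, hz⟩ := gT_surj (shiftM a t) (shiftM b t) (shiftM c t) h3.1 h3.2 h2.2 y
    apply hne'.1
    rw [hT, ← hz]
    exact step_gT f hf m hm ho _ _ _ z
  have hT0 : T = 0 := by
    rcases mul_eq_zero.mp h0 with h | h
    · exact h
    · exfalso
      exact mul_ne_zero (mul_ne_zero (Matrix.charpoly_monic _).ne_zero
        (Matrix.charpoly_monic _).ne_zero) (Matrix.charpoly_monic _).ne_zero h
  have h := hT 0
  rw [hT0, Polynomial.eval_zero, shiftM_zero, shiftM_zero, shiftM_zero] at h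
  exact h.symm

theorem ord7 (f : MvPolynomial Idx ℂ) (hf : Vanish f 6) : OrdGe f 7 := by
  have h : ∀ m, m ≤ 7 → OrdGe f m := by
    intro m
    induction m with
    | zero => intro _ a b c y j hj; exact absurd hj (Nat.not_lt_zero _)
    | succ m ih =>
      intro hm a b c y j hj
      rcases Nat.lt_succ_iff_lt_or_eq.mp hj with h | h
      · exact ih (by omega) a b c y j h
      · rw [h]; exact step_all f hf m (by omega) (ih (by omega)) a b c y
  exact h 7 le_rfl

/-! ### From order of vanishing seven to sums of seven simple tensors -/

def thetaT (σ : Equiv.Perm (Fin 7)) (r : Fin 7) : Polynomial (MvPolynomial (Fin 7) ℂ) :=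
  if (σ.symm r).val < 3 then Polynomial.X * Polynomial.C (MvPolynomial.X r)
  else Polynomial.C (MvPolynomial.X r)

def lowSum (σ : Equiv.Perm (Fin 7)) (n : Fin 7 →₀ ℕ) : ℕ :=
  ∑ r, if (σ.symm r).val < 3 then n r else 0

theorem thetaT_monomial (σ : Equiv.Perm (Fin 7)) (n : Fin 7 →₀ ℕ) (z : ℂ) :
    MvPolynomial.aeval (thetaT σ) (MvPolynomial.monomial n z) =
      Polynomial.C (MvPolynomial.monomial n z) * Polynomial.X ^ (lowSum σ n) := by
  have h1 : ∀ r, thetaT σ r ^ n r = Polynomial.X ^ (if (σ.symm r).val < 3 then n r else 0) *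
      Polynomial.C (MvPolynomial.X r ^ n r) := by
    intro r
    unfold thetaT
    split_ifs with h
    · rw [mul_pow, Polynomial.C_pow]
    · rw [pow_zero, one_mul, Polynomial.C_pow]
  rw [MvPolynomial.aeval_monomial, Finsupp.prod_fintype _ _ (fun i => pow_zero _),
    Finset.prod_congr rfl (fun r _ => h1 r), Finset.prod_mul_distrib, Finset.prod_pow_eq_pow_sum,
    ← map_prod, MvPolynomial.monomial_eq, Finsupp.prod_fintype _ _ (fun i => pow_zero _),
    Polynomial.C_mul]
  have h2 : algebraMap ℂ (Polynomial (MvPolynomial (Fin 7) ℂ)) z =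
    Polynomial.C (MvPolynomial.C z) := rfl
  rw [h2, lowSum]
  ring

theorem thetaT_coeff (σ : Equiv.Perm (Fin 7)) (A : MvPolynomial (Fin 7) ℂ) (l : ℕ)
    (n : Fin 7 →₀ ℕ) : ((MvPolynomial.aeval (thetaT σ) A).coeff l).coeff n =
      if lowSum σ n = l then A.coeff n else 0 := by
  classical
  induction A using MvPolynomial.induction_on' with
  | monomial k z =>
    rw [thetaT_monomial, Polynomial.coeff_C_mul, Polynomial.coeff_X_pow, mul_ite, mul_one, mul_zero]
    by_cases hk : k = n
    · subst hk
      by_cases hl : l = lowSum σ k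
      · rw [if_pos hl, if_pos hl.symm]
      · rw [if_neg hl, if_neg (fun h => hl h.symm), MvPolynomial.coeff_zero]
    · have h0 : (MvPolynomial.monomial k z).coeff n = 0 := by
        rw [MvPolynomial.coeff_monomial, if_neg hk]
      rw [h0, ite_self]
      split_ifs
      · exact h0
      · exact MvPolynomial.coeff_zero _
  | add p q hp hq =>
    rw [map_add, Polynomial.coeff_add, MvPolynomial.coeff_add, hp, hq, MvPolynomial.coeff_add]
    split_ifs
    · rfl
    · exact add_zero _

theorem vanish7 (f : MvPolynomial Idx ℂ) (d : ℕ) (hd : d ≤ 18) (hh : f.IsHomogeneous d)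
    (ho : OrdGe f 7) : Vanish f 7 := by
  intro u v w
  obtain ⟨A, hA⟩ : ∃ A : MvPolynomial (Fin 7) ℂ, A = MvPolynomial.aeval
      (fun x => ∑ r, MvPolynomial.X r * MvPolynomial.C (tens (u r) (v r) (w r) x)) f := ⟨_, rfl⟩
  have hAh : A.IsHomogeneous d := by
    have := hh.aeval (n := 1)
      (fun x => ∑ r, MvPolynomial.X r * MvPolynomial.C (tens (u r) (v r) (w r) x)) (by
        intro x
        apply MvPolynomial.IsHomogeneous.sum
        intro q _
        exact (MvPolynomial.isHomogeneous_X _ q).mul (MvPolynomial.isHomogeneous_C _ _))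
    rw [one_mul] at this
    rw [hA]
    exact this
  have hlow : ∀ (σ : Equiv.Perm (Fin 7)) (l : ℕ), l < 7 →
      (MvPolynomial.aeval (thetaT σ) A).coeff l = 0 := by
    intro σ l hl
    have e : MvPolynomial.aeval (thetaT σ) A = Qg f
        (fun x => ∑ r, if (σ.symm r).val < 3 then 0 else
          MvPolynomial.X r * MvPolynomial.C (tens (u r) (v r) (w r) x))
        (fun x => ∑ r, if (σ.symm r).val < 3 then
          MvPolynomial.X r * MvPolynomial.C (tens (u r) (v r) (w r) x) else 0) := by
      rw [hA, Qg, ← AlgHom.comp_apply, MvPolynomial.comp_aeval]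
      congr 2
      funext x
      rw [map_sum, map_sum, map_sum, Finset.mul_sum, ← Finset.sum_add_distrib]
      apply Finset.sum_congr rfl
      intro r _
      rw [map_mul, MvPolynomial.aeval_X, MvPolynomial.algHom_C]
      have h2 : algebraMap ℂ (Polynomial (MvPolynomial (Fin 7) ℂ)) (tens (u r) (v r) (w r) x) =
        Polynomial.C (MvPolynomial.C (tens (u r) (v r) (w r) x)) := rfl
      rw [h2, thetaT]
      split_ifs
      · rw [map_zero, map_mul]; ring
      · rw [map_zero, map_mul]; ring
    rw [e]
    apply MvPolynomial.funext
    intro s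
    rw [← aevE, Qg_map, map_zero]
    have e2 : (fun x => MvPolynomial.aeval s (∑ r, if (σ.symm r).val < 3 then 0 else
          MvPolynomial.X r * MvPolynomial.C (tens (u r) (v r) (w r) x))) =
        pt (fun k i => s (σ (Fin.natAdd 3 k)) * u (σ (Fin.natAdd 3 k)) i)
          (fun k => v (σ (Fin.natAdd 3 k))) (fun k => w (σ (Fin.natAdd 3 k))) := by
      funext x
      rw [aevE, map_sum, pt, ← Equiv.sum_comp σ]
      simp only [Equiv.symm_apply_apply]
      rw [Fin.sum_univ_seven, Fin.sum_univ_four]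
      simp [tens]
      ring
    rw [e2]
    exact ho _ _ _ _ l hl
  have hA0 : A = 0 := by
    ext n
    rw [MvPolynomial.coeff_zero]
    by_contra hn
    have hdeg : ∑ r, n r = d := by
      have := hAh hn
      rw [Finsupp.weight_apply, Finsupp.sum_fintype _ _ (by simp)] at this
      simpa using this
    have hs : lowSum (Tuple.sort n) n < 7 := by
      have hm : Monotone (n ∘ Tuple.sort n) := Tuple.monotone_sort n
      rw [← Equiv.sum_comp (Tuple.sort n), Fin.sum_univ_seven] at hdeg
      rw [lowSum, ← Equiv.sum_comp (Tuple.sort n), Fin.sum_univ_seven]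
      simp only [Equiv.symm_apply_apply]
      have m1 := hm (show (2 : Fin 7) ≤ 3 by decide)
      have m2 := hm (show (2 : Fin 7) ≤ 4 by decide)
      have m3 := hm (show (2 : Fin 7) ≤ 5 by decide)
      have m4 := hm (show (2 : Fin 7) ≤ 6 by decide)
      have m5 := hm (show (0 : Fin 7) ≤ 2 by decide)
      have m6 := hm (show (1 : Fin 7) ≤ 2 by decide)
      simp only [Function.comp] at m1 m2 m3 m4 m5 m6
      simp
      omega
    have h1 := thetaT_coeff (Tuple.sort n) A (lowSum (Tuple.sort n) n) n
    rw [hlow _ _ hs, if_pos rfl, MvPolynomial.coeff_zero] at h1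
    exact hn h1.symm
  have h := congrArg (MvPolynomial.aeval (fun _ => (1 : ℂ))) hA
  rw [hA0, map_zero, ← AlgHom.comp_apply, MvPolynomial.comp_aeval, aevE] at h
  rw [h]
  congr 2
  funext x
  rw [aevE, map_sum]
  simp

/-! ### The seventh secant variety fills the space -/

def baseU : Fin 7 → Fin 4 → ℂ :=
  ![![1, 0, 0, 0], ![0, 1, 0, 0], ![0, 0, 1, 0], ![0, 0, 0, 1], ![1, 1, 1, 0], ![1, 0, 1, 0], ![0, 1, 1, 1]]
def baseV : Fin 7 → Fin 4 → ℂ :=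
  ![![1, 0, 0, 0], ![0, 1, 0, 0], ![0, 0, 1, 0], ![0, 0, 0, 1], ![1, 0, 0, 0], ![1, 1, 0, 1], ![0, 0, 1, 0]]
def baseW : Fin 7 → Fin 4 → ℂ :=
  ![![1, 0, 0, 0], ![0, 1, 0, 0], ![0, 0, 1, 0], ![0, 0, 0, 1], ![1, 0, 1, 0], ![1, 0, 0, 1], ![0, 1, 1, 0]]

theorem base_dual (F : Idx → ℂ)
    (h0 : ∀ r t, ∑ j, ∑ k, baseV r j * baseW r k * F (t, j, k) = 0)
    (h1 : ∀ r t, ∑ i, ∑ k, baseU r i * baseW r k * F (i, t, k) = 0)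
    (h2 : ∀ r t, ∑ i, ∑ j, baseU r i * baseV r j * F (i, j, t) = 0) : ∀ q, F q = 0 := by
  simp only [Fin.sum_univ_four] at h0 h1 h2
  have hz0 : ∀ t j, F (t, j, j) = 0 := by
    intro t j
    have e0 := h0 0 t
    have e1 := h0 1 t
    have e2 := h0 2 t
    have e3 := h0 3 t
    simp [baseV, baseW] at e0 e1 e2 e3
    fin_cases j
    · exact e0
    · exact e1
    · exact e2
    · exact e3
  have hz1 : ∀ t j, F (j, t, j) = 0 := by
    intro t j
    have e0 := h1 0 t
    have e1 := h1 1 t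
    have e2 := h1 2 t
    have e3 := h1 3 t
    simp [baseU, baseW] at e0 e1 e2 e3
    fin_cases j
    · exact e0
    · exact e1
    · exact e2
    · exact e3
  have hz2 : ∀ t j, F (j, j, t) = 0 := by
    intro t j
    have e0 := h2 0 t
    have e1 := h2 1 t
    have e2 := h2 2 t
    have e3 := h2 3 t
    simp [baseU, baseV] at e0 e1 e2 e3
    fin_cases j
    · exact e0
    · exact e1
    · exact e2
    · exact e3
  have g001 : F (1, 0, 2) = 0 := by
    have e := h0 4 1
    simp [baseU, baseV, baseW, hz0, hz1, hz2] at e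
    linear_combination e
  have g003 : F (3, 0, 2) = 0 := by
    have e := h0 4 3
    simp [baseU, baseV, baseW, hz0, hz1, hz2] at e
    linear_combination e
  have g011 : F (0, 1, 2) + F (2, 1, 0) = 0 := by
    have e := h1 4 1
    simp [baseU, baseV, baseW, hz0, hz1, hz2] at e
    linear_combination e
  have g012 : F (1, 2, 0) = 0 := by
    have e := h1 4 2
    simp [baseU, baseV, baseW, hz0, hz1, hz2] at e
    linear_combination e
  have g013 : F (0, 3, 2) + F (1, 3, 0) + F (1, 3, 2) + F (2, 3, 0) = 0 := by
    have e := h1 4 3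
    simp [baseU, baseV, baseW, hz0, hz1, hz2] at e
    linear_combination e
  have g021 : F (2, 0, 1) = 0 := by
    have e := h2 4 1
    simp [baseU, baseV, baseW, hz0, hz1, hz2] at e
    linear_combination e
  have g023 : F (1, 0, 3) + F (2, 0, 3) = 0 := by
    have e := h2 4 3
    simp [baseU, baseV, baseW, hz0, hz1, hz2] at e
    linear_combination e
  have g100 : F (0, 1, 3) = 0 := by
    have e := h0 5 0
    simp [baseU, baseV, baseW, hz0, hz1, hz2] at e
    linear_combination e
  have g101 : F (1, 0, 3) + F (1, 3, 0) = 0 := by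
    have e := h0 5 1
    simp [baseU, baseV, baseW, hz0, hz1, hz2] at e
    linear_combination e
  have g102 : F (2, 0, 3) + F (2, 1, 0) + F (2, 1, 3) + F (2, 3, 0) = 0 := by
    have e := h0 5 2
    simp [baseU, baseV, baseW, hz0, hz1, hz2] at e
    linear_combination e
  have g103 : F (3, 1, 0) = 0 := by
    have e := h0 5 3
    simp [baseU, baseV, baseW, hz0, hz1, hz2] at e
    linear_combination e
  have g110 : F (2, 0, 3) = 0 := by
    have e := h1 5 0
    simp [baseU, baseV, baseW, hz0, hz1, hz2] at e
    linear_combination e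
  have g112 : F (0, 2, 3) = 0 := by
    have e := h1 5 2
    simp [baseU, baseV, baseW, hz0, hz1, hz2] at e
    linear_combination e
  have g113 : F (2, 3, 0) = 0 := by
    have e := h1 5 3
    simp [baseU, baseV, baseW, hz0, hz1, hz2] at e
    linear_combination e
  have g120 : F (2, 1, 0) + F (2, 3, 0) = 0 := by
    have e := h2 5 0
    simp [baseU, baseV, baseW, hz0, hz1, hz2] at e
    linear_combination e
  have g121 : F (0, 3, 1) + F (2, 0, 1) + F (2, 3, 1) = 0 := by
    have e := h2 5 1
    simp [baseU, baseV, baseW, hz0, hz1, hz2] at e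
    linear_combination e
  have g122 : F (0, 1, 2) + F (0, 3, 2) = 0 := by
    have e := h2 5 2
    simp [baseU, baseV, baseW, hz0, hz1, hz2] at e
    linear_combination e
  have g200 : F (0, 2, 1) = 0 := by
    have e := h0 6 0
    simp [baseU, baseV, baseW, hz0, hz1, hz2] at e
    linear_combination e
  have g203 : F (3, 2, 1) = 0 := by
    have e := h0 6 3
    simp [baseU, baseV, baseW, hz0, hz1, hz2] at e
    linear_combination e
  have g210 : F (1, 0, 2) + F (2, 0, 1) + F (3, 0, 1) + F (3, 0, 2) = 0 := by
    have e := h1 6 0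
    simp [baseU, baseV, baseW, hz0, hz1, hz2] at e
    linear_combination e
  have g211 : F (3, 1, 2) = 0 := by
    have e := h1 6 1
    simp [baseU, baseV, baseW, hz0, hz1, hz2] at e
    linear_combination e
  have g213 : F (1, 3, 2) + F (2, 3, 1) = 0 := by
    have e := h1 6 3
    simp [baseU, baseV, baseW, hz0, hz1, hz2] at e
    linear_combination e
  have g220 : F (1, 2, 0) + F (3, 2, 0) = 0 := by
    have e := h2 6 0
    simp [baseU, baseV, baseW, hz0, hz1, hz2] at e
    linear_combination e
  have g223 : F (1, 2, 3) = 0 := by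
    have e := h2 6 3
    simp [baseU, baseV, baseW, hz0, hz1, hz2] at e
    linear_combination e
  have f012 : F (0, 1, 2) = 0 := by
    linear_combination (1) * g011 + (1) * g113 + (-1) * g120
  have f013 : F (0, 1, 3) = 0 := by
    linear_combination (1) * g100
  have f021 : F (0, 2, 1) = 0 := by
    linear_combination (1) * g200
  have f023 : F (0, 2, 3) = 0 := by
    linear_combination (1) * g112
  have f031 : F (0, 3, 1) = 0 := by
    linear_combination (1) * g011 + (1) * g013 + (-1) * g021 + (1) * g023 + (-1) * g101 + (-1) * g110 + (-1) * g120 + (1) * g121 + (-1) * g122 + (-1) * g213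
  have f032 : F (0, 3, 2) = 0 := by
    linear_combination (-1) * g011 + (-1) * g113 + (1) * g120 + (1) * g122
  have f102 : F (1, 0, 2) = 0 := by
    linear_combination (1) * g001
  have f103 : F (1, 0, 3) = 0 := by
    linear_combination (1) * g023 + (-1) * g110
  have f120 : F (1, 2, 0) = 0 := by
    linear_combination (1) * g012
  have f123 : F (1, 2, 3) = 0 := by
    linear_combination (1) * g223
  have f130 : F (1, 3, 0) = 0 := by
    linear_combination (-1) * g023 + (1) * g101 + (1) * g110
  have f132 : F (1, 3, 2) = 0 := by
    linear_combination (1) * g011 + (1) * g013 + (1) * g023 + (-1) * g101 + (-1) * g110 + (-1) * g120 + (-1) * g122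
  have f201 : F (2, 0, 1) = 0 := by
    linear_combination (1) * g021
  have f203 : F (2, 0, 3) = 0 := by
    linear_combination (1) * g110
  have f210 : F (2, 1, 0) = 0 := by
    linear_combination (-1) * g113 + (1) * g120
  have f213 : F (2, 1, 3) = 0 := by
    linear_combination (1) * g102 + (-1) * g110 + (-1) * g120
  have f230 : F (2, 3, 0) = 0 := by
    linear_combination (1) * g113
  have f231 : F (2, 3, 1) = 0 := by
    linear_combination (-1) * g011 + (-1) * g013 + (-1) * g023 + (1) * g101 + (1) * g110 + (1) * g120 + (1) * g122 + (1) * g213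
  have f301 : F (3, 0, 1) = 0 := by
    linear_combination (-1) * g001 + (-1) * g003 + (-1) * g021 + (1) * g210
  have f302 : F (3, 0, 2) = 0 := by
    linear_combination (1) * g003
  have f310 : F (3, 1, 0) = 0 := by
    linear_combination (1) * g103
  have f312 : F (3, 1, 2) = 0 := by
    linear_combination (1) * g211
  have f320 : F (3, 2, 0) = 0 := by
    linear_combination (-1) * g012 + (1) * g220
  have f321 : F (3, 2, 1) = 0 := by
    linear_combination (1) * g203
  rintro ⟨i, j, k⟩
  by_cases hij : i = j
  · subst hij; exact hz2 _ _
  by_cases hjk : j = k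
  · subst hjk; exact hz0 _ _
  by_cases hik : i = k
  · subst hik; exact hz1 _ _
  fin_cases i <;> fin_cases j <;> fin_cases k <;> first | contradiction | assumption

abbrev Par := (Fin 7 → Fin 4 → ℂ) × (Fin 7 → Fin 4 → ℂ) × (Fin 7 → Fin 4 → ℂ)

def Phi (p : Par) : Idx → ℂ := fun x => ∑ l, tens (p.1 l) (p.2.1 l) (p.2.2 l) x

theorem Phi_contDiff : ContDiff ℂ 1 Phi := by
  rw [contDiff_pi]
  intro x
  unfold Phi tens
  fun_prop

theorem Phi_fderiv (p h : Par) (w : Idx → ℂ) (hw : ∀ t : ℂ, Phi (p + t • h) = Phi p + t • w) :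
    fderiv ℂ Phi p h = w := by
  have hd : DifferentiableAt ℂ Phi p := Phi_contDiff.differentiable (by simp) p
  have h1 : HasLineDerivAt ℂ Phi (fderiv ℂ Phi p h) p h := hd.hasFDerivAt.hasLineDerivAt h
  have h2 : HasLineDerivAt ℂ Phi w p h := by
    unfold HasLineDerivAt
    have e : (fun t : ℂ => Phi (p + t • h)) = fun t => Phi p + t • w := funext hw
    rw [e]
    simpa using ((hasDerivAt_id (0 : ℂ)).smul_const w).const_add (Phi p)
  exact h1.lineDeriv.symm.trans h2.lineDeriv

theorem Phi_range : (fderiv ℂ Phi (baseU, baseV, baseW)).range = ⊤ := by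
  by_contra hne
  obtain ⟨φ, hφ0, hφ⟩ := Submodule.exists_le_ker_of_lt_top _ (lt_top_iff_ne_top.mpr hne)
  apply hφ0
  have hk : ∀ h : Par, φ (fderiv ℂ Phi (baseU, baseV, baseW) h) = 0 := by
    intro h
    exact hφ ⟨h, rfl⟩
  have hsum : ∀ y : Idx → ℂ, φ y = ∑ q, y q * φ (Pi.single q 1) := by
    intro y
    rw [LinearMap.pi_apply_eq_sum_univ φ y]
    apply Finset.sum_congr rfl
    intro q _
    rw [smul_eq_mul]
    congr 2
    funext j
    simp [Pi.single_apply, eq_comm]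
  have hF := base_dual (fun q => φ (Pi.single q 1)) ?_ ?_ ?_
  · apply LinearMap.ext
    intro y
    rw [hsum]
    apply Finset.sum_eq_zero
    intro q _
    rw [hF q, mul_zero]
  · intro r t
    have e := hk (Pi.single r (Pi.single t 1), 0, 0)
    rw [Phi_fderiv _ _ (tens (Pi.single t 1) (baseV r) (baseW r)), hsum] at e
    · simpa [Fintype.sum_prod_type, tens, Pi.single_apply] using e
    · intro s
      funext x
      simp only [Phi, Pi.add_apply, Pi.smul_apply, Prod.fst_add, Prod.snd_add, Prod.smul_fst,
        Prod.smul_snd, tens, add_mul, Finset.sum_add_distrib, smul_eq_mul, mul_zero, add_zero,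
        Pi.zero_apply]
      congr 1
      rw [Finset.sum_eq_single r]
      · rw [Pi.single_eq_same]; ring
      · intro b _ hb; rw [Pi.single_eq_of_ne hb]; simp
      · simp
  · intro r t
    have e := hk (0, Pi.single r (Pi.single t 1), 0)
    rw [Phi_fderiv _ _ (tens (baseU r) (Pi.single t 1) (baseW r)), hsum] at e
    · simpa [Fintype.sum_prod_type, tens, Pi.single_apply] using e
    · intro s
      funext x
      simp only [Phi, Pi.add_apply, Pi.smul_apply, Prod.fst_add, Prod.snd_add, Prod.smul_fst,
        Prod.smul_snd, tens, add_mul, mul_add, Finset.sum_add_distrib, smul_eq_mul, mul_zero,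
        add_zero, Pi.zero_apply]
      congr 1
      rw [Finset.sum_eq_single r]
      · rw [Pi.single_eq_same]; ring
      · intro b _ hb; rw [Pi.single_eq_of_ne hb]; simp
      · simp
  · intro r t
    have e := hk (0, 0, Pi.single r (Pi.single t 1))
    rw [Phi_fderiv _ _ (tens (baseU r) (baseV r) (Pi.single t 1)), hsum] at e
    · simpa [Fintype.sum_prod_type, tens, Pi.single_apply] using e
    · intro s
      funext x
      simp only [Phi, Pi.add_apply, Pi.smul_apply, Prod.fst_add, Prod.snd_add, Prod.smul_fst,
        Prod.smul_snd, tens, mul_add, Finset.sum_add_distrib, smul_eq_mul, mul_zero, add_zero,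
        Pi.zero_apply]
      congr 1
      rw [Finset.sum_eq_single r]
      · rw [Pi.single_eq_same]; ring
      · intro b _ hb; rw [Pi.single_eq_of_ne hb]; simp
      · simp

theorem zero_of_vanish7 (f : MvPolynomial Idx ℂ) (hf : Vanish f 7) : f = 0 := by
  have hs : HasStrictFDerivAt Phi (fderiv ℂ Phi (baseU, baseV, baseW)) (baseU, baseV, baseW) :=
    Phi_contDiff.contDiffAt.hasStrictFDerivAt (by simp)
  have hm := hs.map_nhds_eq_of_surj Phi_range
  have hev : ∀ᶠ y in nhds (Phi (baseU, baseV, baseW)), MvPolynomial.eval y f = 0 := by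
    rw [← hm, Filter.eventually_map]
    exact Filter.Eventually.of_forall (fun p => hf p.1 p.2.1 p.2.2)
  obtain ⟨ε, hε, hb⟩ := Metric.eventually_nhds_iff_ball.mp hev
  apply MvPolynomial.funext_set (fun x => Metric.ball (Phi (baseU, baseV, baseW) x) ε)
  · intro x
    have hx : Metric.ball (Phi (baseU, baseV, baseW) x) ε ∈ nhds (Phi (baseU, baseV, baseW) x) :=
      Metric.ball_mem_nhds _ hε
    exact infinite_of_mem_nhds _ hx
  · intro y hy
    rw [map_zero]
    apply hb
    rw [ball_pi _ hε]
    exact hy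

end Sigma6

/-- every homogeneous polynomial of degree at most 18 on `ℂ⁴⊗ℂ⁴⊗ℂ⁴`
vanishing on all tensors of rank at most 6 is zero, i.e. the ideal of
`σ₆(Seg(ℙ³×ℙ³×ℙ³))` is empty in degrees less than 19. -/
theorem ideal_sigma6_empty_in_low_degrees
    (d : ℕ) (hd : d ≤ 18) (P : MvPolynomial (Fin 4 × Fin 4 × Fin 4) ℂ)
    (hP : P.IsHomogeneous d)
    (hvan : ∀ T : Fin 4 → Fin 4 → Fin 4 → ℂ, rankLE T 6 →
      MvPolynomial.eval (fun x => T x.1 x.2.1 x.2.2) P = 0) :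
    P = 0 := by
  have hf : Sigma6.Vanish P 6 := by
    intro u v w
    exact hvan (fun i j k => ∑ l, u l i * v l j * w l k) ⟨u, v, w, rfl⟩
  exact Sigma6.zero_of_vanish7 P (Sigma6.vanish7 P d hd hP (Sigma6.ord7 P hf))

end
end
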